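/- arXiv:1311.7475 — 2 statements merged into one kernel-verified Lean document; each statement's English description precedes it below -/
import Mathlib

section
/- The function l(ν) := 2∫_{−ξ(ν)}^{0} m(t)/√(m(t)² − ν²) dt is differentiable on (inf m, m(0)) and its derivative satisfies l'(ν) = ν·φ'(ν) for every ν ∈ (inf m, m(0)). -/
open Real Set

noncomputable section

/-- Length of a C¹ curve `c` on `[a,b]` in the warped product metric
`ds² = dt² + m(t)² dθ²` on `M̃ = ℝ²` (coordinates `(t,θ)`). -/
def wLength (m : ℝ → ℝ) (c : ℝ → ℝ × ℝ) (a b : ℝ) : ℝ :=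
  ∫ s in a..b,
    Real.sqrt ((deriv (fun u => (c u).1) s) ^ 2 +
      (m (c s).1) ^ 2 * (deriv (fun u => (c u).2) s) ^ 2)

/-- The Riemannian distance on `M̃`: the infimum of lengths of C¹ curves joining `p` to `q`. -/
def wDist (m : ℝ → ℝ) (p q : ℝ × ℝ) : ℝ :=
  sInf {L : ℝ | ∃ c : ℝ → ℝ × ℝ, ∃ b : ℝ, 0 ≤ b ∧ ContDiff ℝ 1 c ∧
    c 0 = p ∧ c b = q ∧ L = wLength m c 0 b}

/-- `γ = (t(s), θ(s))` is a unit-speed geodesic of the warped product metric: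
`t'' = m(t) m'(t) θ'²`, `m(t)² θ'` is constant, and `t'² + m(t)² θ'² = 1`. -/
def IsUnitGeodesic (m : ℝ → ℝ) (γ : ℝ → ℝ × ℝ) : Prop :=
  ContDiff ℝ 2 γ ∧
  (∀ s, deriv (deriv fun u => (γ u).1) s =
      m (γ s).1 * deriv m (γ s).1 * (deriv (fun u => (γ u).2) s) ^ 2) ∧
  (∃ ν : ℝ, ∀ s, m (γ s).1 ^ 2 * deriv (fun u => (γ u).2) s = ν) ∧
  (∀ s, (deriv (fun u => (γ u).1) s) ^ 2 +
      m (γ s).1 ^ 2 * (deriv (fun u => (γ u).2) s) ^ 2 = 1)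

/-- `ν` is the Clairaut constant of the geodesic `γ`: `m(t(s))² θ'(s) = ν` for all `s`. -/
def HasClairaut (m : ℝ → ℝ) (γ : ℝ → ℝ × ℝ) (ν : ℝ) : Prop :=
  ∀ s, m (γ s).1 ^ 2 * deriv (fun u => (γ u).2) s = ν

/-- The (unit-speed) geodesic segment `γ|[0,a]` is minimal: its length `a` equals
the distance between its endpoints. -/
def IsMinimalSeg (m : ℝ → ℝ) (γ : ℝ → ℝ × ℝ) (a : ℝ) : Prop :=
  wDist m (γ 0) (γ a) = a

/-- `x` is a cut point of `p`: the endpoint of some minimal geodesic segment from `p`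
no extension of which is minimal. -/
def IsCutPoint (m : ℝ → ℝ) (p x : ℝ × ℝ) : Prop :=
  ∃ γ : ℝ → ℝ × ℝ, ∃ a : ℝ, IsUnitGeodesic m γ ∧ γ 0 = p ∧ 0 < a ∧ γ a = x ∧
    IsMinimalSeg m γ a ∧ ∀ ε > 0, ¬ IsMinimalSeg m γ (a + ε)

/-- The cut locus of `p` in `M̃`. -/
def cutLocus (m : ℝ → ℝ) (p : ℝ × ℝ) : Set (ℝ × ℝ) := {x | IsCutPoint m p x}

/-- The Gaussian curvature `K(t) = -m''(t)/m(t)` of the warped product metric. -/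
def gaussK (m : ℝ → ℝ) (t : ℝ) : ℝ := -(deriv (deriv m) t) / m t

/-- `ξ(ν) := min {t > 0 | m t = ν}`. -/
def xi (m : ℝ → ℝ) (ν : ℝ) : ℝ := sInf {t : ℝ | 0 < t ∧ m t = ν}

/-- `φ(ν) := 2∫₀^{ξ(ν)} ν / (m(t) √(m(t)² - ν²)) dt`. -/
def phi (m : ℝ → ℝ) (ν : ℝ) : ℝ :=
  2 * ∫ t in (0:ℝ)..(xi m ν), ν / (m t * Real.sqrt ((m t) ^ 2 - ν ^ 2))

/-- `l(ν) := 2∫_{-ξ(ν)}^{0} m(t) / √(m(t)² - ν²) dt`. -/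
def ell (m : ℝ → ℝ) (ν : ℝ) : ℝ :=
  2 * ∫ t in (-(xi m ν))..(0:ℝ), m t / Real.sqrt ((m t) ^ 2 - ν ^ 2)

/-- `inf m`. -/
def infm (m : ℝ → ℝ) : ℝ := ⨅ t : ℝ, m t

/-- `t₀ := sup {t > 0 | m'(t) < 0}`. -/
def tZero (m : ℝ → ℝ) : ℝ := sSup {t : ℝ | 0 < t ∧ deriv m t < 0}


/-- Differentiation under the integral, jointly continuous derivative. -/
lemma hasDerivAt_param (F F' : ℝ → ℝ → ℝ) (a b : ℝ) (hab : a ≤ b) (lo hi ν : ℝ)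
    (hν : ν ∈ Ioo lo hi)
    (hF : ∀ y ∈ Ioo lo hi, ContinuousOn (F y) (Icc a b))
    (hd : ∀ y ∈ Ioo lo hi, ∀ x ∈ Icc a b, HasDerivAt (fun z => F z x) (F' y x) y)
    (hF' : ContinuousOn (fun q : ℝ × ℝ => F' q.1 q.2) (Ioo lo hi ×ˢ Icc a b)) :
    HasDerivAt (fun y => ∫ x in a..b, F y x) (∫ x in a..b, F' ν x) ν := by
  obtain ⟨l1, hl1, hl1'⟩ := exists_between hν.1
  obtain ⟨u1, hu1, hu1'⟩ := exists_between hν.2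
  have hsub : Icc l1 u1 ⊆ Ioo lo hi := fun y hy => ⟨hl1.trans_le hy.1, hy.2.trans_lt hu1'⟩
  have hcomp : IsCompact (Icc l1 u1 ×ˢ Icc a b) := isCompact_Icc.prod isCompact_Icc
  obtain ⟨C, hC⟩ := hcomp.exists_bound_of_continuousOn
    (hF'.mono (prod_mono hsub Subset.rfl))
  have huI : Set.uIoc a b ⊆ Icc a b := by
    rw [uIoc_of_le hab]; exact Ioc_subset_Icc_self
  have hmeas : ∀ f : ℝ → ℝ, ContinuousOn f (Icc a b) →
      MeasureTheory.AEStronglyMeasurable f (MeasureTheory.volume.restrict (Set.uIoc a b)) := by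
    intro f hf
    exact (hf.mono huI).aestronglyMeasurable measurableSet_uIoc
  refine (intervalIntegral.hasDerivAt_integral_of_dominated_loc_of_deriv_le
    (bound := fun _ => C) (s := Ioo l1 u1) (Ioo_mem_nhds hl1' hu1) ?_ ?_ ?_ ?_ ?_ ?_).2
  · filter_upwards [Ioo_mem_nhds hν.1 hν.2] with y hy using hmeas _ (hF y hy)
  · apply ContinuousOn.intervalIntegrable
    rw [uIcc_of_le hab]; exact hF ν hν
  · apply hmeas
    exact hF'.comp (f := fun x => (ν, x)) (by fun_prop) (fun x hx => ⟨hν, hx⟩)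
  · refine Filter.Eventually.of_forall fun x hx y hy => ?_
    exact hC (y, x) ⟨Ioo_subset_Icc_self hy, huI hx⟩
  · simp
  · refine Filter.Eventually.of_forall fun x hx y hy => ?_
    exact hd y (hsub (Ioo_subset_Icc_self hy)) x (huI hx)

/-- `s(ν,x)`. -/
def sfun (c ν x : ℝ) : ℝ := Real.sqrt (ν ^ 2 * (1 - x ^ 2) + c ^ 2 * x ^ 2)

lemma sfun_arg_pos {c ν x : ℝ} (hν : 0 < ν) (hc : ν < c) (hx : x ∈ Icc (0:ℝ) 1) :
    ν ^ 2 ≤ ν ^ 2 * (1 - x ^ 2) + c ^ 2 * x ^ 2 ∧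
      ν ^ 2 * (1 - x ^ 2) + c ^ 2 * x ^ 2 ≤ c ^ 2 := by
  have h1 : ν ^ 2 ≤ c ^ 2 := by gcongr
  have h2 : x ^ 2 ≤ 1 := by nlinarith [hx.1, hx.2]
  constructor
  · nlinarith [mul_nonneg (sub_nonneg.2 h1) (sq_nonneg x)]
  · nlinarith [mul_nonneg (sub_nonneg.2 h1) (sub_nonneg.2 h2)]

lemma sfun_mem {c ν x : ℝ} (hν : 0 < ν) (hc : ν < c) (hx : x ∈ Icc (0:ℝ) 1) :
    sfun c ν x ∈ Icc ν c := by
  obtain ⟨h1, h2⟩ := sfun_arg_pos hν hc hx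
  exact ⟨Real.le_sqrt_of_sq_le h1, Real.sqrt_le_iff.2 ⟨(hν.trans hc).le, h2⟩⟩

lemma sfun_cont (c : ℝ) : Continuous (fun q : ℝ × ℝ => sfun c q.1 q.2) := by
  unfold sfun; fun_prop

lemma sfun_sq {c ν x : ℝ} (hν : 0 < ν) (hc : ν < c) (hx : x ∈ Icc (0:ℝ) 1) :
    sfun c ν x ^ 2 = ν ^ 2 * (1 - x ^ 2) + c ^ 2 * x ^ 2 :=
  Real.sq_sqrt ((sq_nonneg ν).trans (sfun_arg_pos hν hc hx).1)

lemma sfun_deriv_nu {c ν x : ℝ} (hν : 0 < ν) (hc : ν < c) (hx : x ∈ Icc (0:ℝ) 1) :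
    HasDerivAt (fun y => sfun c y x) (ν * (1 - x ^ 2) / sfun c ν x) ν := by
  have h0 := (pow_pos hν 2).trans_le (sfun_arg_pos hν hc hx).1
  have h : HasDerivAt (fun y : ℝ => y ^ 2 * (1 - x ^ 2) + c ^ 2 * x ^ 2)
      ((2 * ν) * (1 - x ^ 2)) ν := by
    have := ((hasDerivAt_pow 2 ν).mul_const (1 - x ^ 2)).add_const (c ^ 2 * x ^ 2)
    simpa using this
  have := h.sqrt h0.ne'
  refine this.congr_deriv ?_
  unfold sfun
  field_simp

lemma sfun_deriv_x {c ν x : ℝ} (hν : 0 < ν) (hc : ν < c) (hx : x ∈ Icc (0:ℝ) 1) :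
    HasDerivAt (fun y => sfun c ν y) ((c ^ 2 - ν ^ 2) * x / sfun c ν x) x := by
  have h0 := (pow_pos hν 2).trans_le (sfun_arg_pos hν hc hx).1
  have h : HasDerivAt (fun y : ℝ => ν ^ 2 * (1 - y ^ 2) + c ^ 2 * y ^ 2)
      (2 * ((c ^ 2 - ν ^ 2) * x)) x := by
    have := (((hasDerivAt_pow 2 x).const_sub 1).const_mul (ν ^ 2)).fun_add
      ((hasDerivAt_pow 2 x).const_mul (c ^ 2))
    refine this.congr_deriv ?_
    simp; ring
  have := h.sqrt h0.ne'
  refine this.congr_deriv ?_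
  unfold sfun
  field_simp

/-- The near-turning-point part. -/
lemma near_part (p p' : ℝ → ℝ) (lo hi c ν : ℝ) (hlo : 0 < lo) (hc : c < hi) (hν : ν ∈ Ioo lo c)
    (hp : ∀ s ∈ Ioo lo hi, HasDerivAt p (p' s) s) (hp' : ContinuousOn p' (Ioo lo hi)) :
    DifferentiableAt ℝ (fun y => Real.sqrt (c ^ 2 - y ^ 2) * ∫ x in (0:ℝ)..1, p (sfun c y x)) ν ∧
    HasDerivAt (fun y => Real.sqrt (c ^ 2 - y ^ 2) ^ 3 * ∫ x in (0:ℝ)..1, x ^ 2 * p (sfun c y x))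
      (-ν * (Real.sqrt (c ^ 2 - ν ^ 2) * ∫ x in (0:ℝ)..1, p (sfun c ν x))) ν := by
  have hpc : ContinuousOn p (Ioo lo hi) := fun s hs => (hp s hs).continuousAt.continuousWithinAt
  have hmem : ∀ y ∈ Ioo lo c, ∀ x ∈ Icc (0:ℝ) 1, sfun c y x ∈ Ioo lo hi := fun y hy x hx => by
    have := sfun_mem (hlo.trans hy.1) hy.2 hx
    exact ⟨hy.1.trans_le this.1, this.2.trans_lt hc⟩
  have hspos : ∀ y ∈ Ioo lo c, ∀ x ∈ Icc (0:ℝ) 1, 0 < sfun c y x := fun y hy x hx =>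
    hlo.trans (hmem y hy x hx).1
  have hx1 : ∀ y : ℝ, Continuous (fun x => sfun c y x) := fun y =>
    (sfun_cont c).comp (by fun_prop : Continuous fun x : ℝ => (y, x))
  have hpx : ∀ y ∈ Ioo lo c, ContinuousOn (fun x => p (sfun c y x)) (Icc 0 1) := fun y hy =>
    hpc.comp (hx1 y).continuousOn (hmem y hy)
  have hp'x : ∀ y ∈ Ioo lo c, ContinuousOn (fun x => p' (sfun c y x)) (Icc 0 1) := fun y hy =>
    hp'.comp (hx1 y).continuousOn (hmem y hy)
  have key : ∀ w : ℝ → ℝ, Continuous w → HasDerivAt (fun y => ∫ x in (0:ℝ)..1, w x * p (sfun c y x))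
      (∫ x in (0:ℝ)..1, w x * (p' (sfun c ν x) * (ν * (1 - x ^ 2) / sfun c ν x))) ν := by
    intro w hw
    refine hasDerivAt_param (fun y x => w x * p (sfun c y x))
      (fun y x => w x * (p' (sfun c y x) * (y * (1 - x ^ 2) / sfun c y x))) 0 1 zero_le_one lo c ν hν
      ?_ ?_ ?_
    · intro y hy
      exact hw.continuousOn.mul (hpx y hy)
    · intro y hy x hx
      exact ((hp _ (hmem y hy x hx)).comp y
        (sfun_deriv_nu (hlo.trans hy.1) hy.2 hx)).const_mul (w x)
    · refine (hw.comp continuous_snd).continuousOn.mul (ContinuousOn.mul ?_ (ContinuousOn.div ?_ ?_ ?_))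
      · exact hp'.comp (sfun_cont c).continuousOn (fun q hq => hmem _ hq.1 _ hq.2)
      · fun_prop
      · exact (sfun_cont c).continuousOn
      · exact fun q hq => (hspos _ hq.1 _ hq.2).ne'
  have hν0 : 0 < ν := hlo.trans hν.1
  have hR0 : 0 < c ^ 2 - ν ^ 2 := by nlinarith [hν.2]
  have hR : HasDerivAt (fun y => Real.sqrt (c ^ 2 - y ^ 2)) (-ν / Real.sqrt (c ^ 2 - ν ^ 2)) ν := by
    have := ((hasDerivAt_pow 2 ν).const_sub (c ^ 2)).sqrt hR0.ne'
    refine this.congr_deriv ?_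
    simp; field_simp
  have hRp := Real.sqrt_pos.2 hR0
  have hRsq := Real.sq_sqrt hR0.le
  set R := Real.sqrt (c ^ 2 - ν ^ 2) with hRdef
  constructor
  · have := key (fun _ => 1) continuous_const
    simp only [one_mul] at this
    exact hR.differentiableAt.mul this.differentiableAt
  · have h2 := (hR.pow 3).mul (key (fun x => x ^ 2) (by fun_prop))
    refine HasDerivAt.congr_deriv h2 ?_
    -- FTC
    have hftc : ∫ x in (0:ℝ)..1, ((1 - 3 * x ^ 2) * p (sfun c ν x) + (x - x ^ 3) *
        (p' (sfun c ν x) * ((c ^ 2 - ν ^ 2) * x / sfun c ν x))) = 0 := by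
      have hd : ∀ x ∈ uIcc (0:ℝ) 1, HasDerivAt (fun x => (x - x ^ 3) * p (sfun c ν x))
          ((1 - 3 * x ^ 2) * p (sfun c ν x) + (x - x ^ 3) *
        (p' (sfun c ν x) * ((c ^ 2 - ν ^ 2) * x / sfun c ν x))) x := by
        intro x hx
        rw [uIcc_of_le zero_le_one] at hx
        have e1 : HasDerivAt (fun x : ℝ => x - x ^ 3) (1 - 3 * x ^ 2) x := by
          have := (hasDerivAt_id' x).fun_sub (hasDerivAt_pow 3 x)
          simpa using this
        exact e1.mul ((hp _ (hmem ν hν x hx)).comp x (sfun_deriv_x hν0 hν.2 hx))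
      rw [intervalIntegral.integral_eq_sub_of_hasDerivAt hd]
      · simp
      · apply ContinuousOn.intervalIntegrable
        rw [uIcc_of_le zero_le_one]
        refine ContinuousOn.add (ContinuousOn.mul (by fun_prop) (hpx ν hν))
          (ContinuousOn.mul (by fun_prop) ((hp'x ν hν).mul (ContinuousOn.div (by fun_prop)
            (hx1 ν).continuousOn (fun x hx => (hspos ν hν x hx).ne'))))
    have i1 : IntervalIntegrable (fun x => p (sfun c ν x)) MeasureTheory.volume 0 1 := by
      apply ContinuousOn.intervalIntegrable
      rw [uIcc_of_le zero_le_one]; exact hpx ν hν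
    have i2 : IntervalIntegrable (fun x => x ^ 2 * p (sfun c ν x)) MeasureTheory.volume 0 1 := by
      apply ContinuousOn.intervalIntegrable
      rw [uIcc_of_le zero_le_one]; exact ContinuousOn.mul (by fun_prop) (hpx ν hν)
    have i3 : IntervalIntegrable (fun x => x ^ 2 * (p' (sfun c ν x) * (ν * (1 - x ^ 2) / sfun c ν x)))
        MeasureTheory.volume 0 1 := by
      apply ContinuousOn.intervalIntegrable
      rw [uIcc_of_le zero_le_one]
      exact ContinuousOn.mul (by fun_prop) ((hp'x ν hν).mul (ContinuousOn.div (by fun_prop)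
            (hx1 ν).continuousOn (fun x hx => (hspos ν hν x hx).ne')))
    have e : ∫ x in (0:ℝ)..1, ((1 - 3 * x ^ 2) * p (sfun c ν x) + (x - x ^ 3) *
        (p' (sfun c ν x) * ((c ^ 2 - ν ^ 2) * x / sfun c ν x))) =
        ∫ x in (0:ℝ)..1, ((p (sfun c ν x) - 3 * (x ^ 2 * p (sfun c ν x))) + R ^ 2 / ν *
        (x ^ 2 * (p' (sfun c ν x) * (ν * (1 - x ^ 2) / sfun c ν x)))) := by
      apply intervalIntegral.integral_congr
      intro x hx
      rw [uIcc_of_le zero_le_one] at hx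
      have := (hspos ν hν x hx).ne'
      simp only [hRsq]
      field_simp
    rw [e, intervalIntegral.integral_add (i1.sub (i2.const_mul 3)) (i3.const_mul _),
      intervalIntegral.integral_sub i1 (i2.const_mul 3), intervalIntegral.integral_const_mul,
      intervalIntegral.integral_const_mul] at hftc
    set B1 := ∫ x in (0:ℝ)..1, p (sfun c ν x)
    set B2 := ∫ x in (0:ℝ)..1, x ^ 2 * p (sfun c ν x)
    set B3 := ∫ x in (0:ℝ)..1, x ^ 2 * (p' (sfun c ν x) * (ν * (1 - x ^ 2) / sfun c ν x))
    have : B1 = 3 * B2 - R ^ 2 / ν * B3 := by linarith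
    simp only [this]
    simp [← hRdef]
    field_simp
    ring

/-- The regular part. -/
lemma far_part (m : ℝ → ℝ) (hm : Continuous m) (hmpos : ∀ t, 0 < m t) (a c ν : ℝ) (ha : 0 ≤ a)
    (hac : ∀ t ∈ Icc 0 a, c ≤ m t) (hν : ν ∈ Ioo 0 c) :
    DifferentiableAt ℝ (fun y => ∫ t in (0:ℝ)..a, 1 / (m t * Real.sqrt (m t ^ 2 - y ^ 2))) ν ∧
    HasDerivAt (fun y => ∫ t in (0:ℝ)..a, Real.sqrt (m t ^ 2 - y ^ 2) / m t)
      (-ν * ∫ t in (0:ℝ)..a, 1 / (m t * Real.sqrt (m t ^ 2 - ν ^ 2))) ν := by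
  have hpos : ∀ y ∈ Ioo 0 c, ∀ t ∈ Icc 0 a, 0 < m t ^ 2 - y ^ 2 := by
    intro y hy t ht
    have := hac t ht
    nlinarith [hy.1, hy.2]
  have hS : ∀ y ∈ Ioo 0 c, ∀ t ∈ Icc 0 a, HasDerivAt (fun y => Real.sqrt (m t ^ 2 - y ^ 2))
      (-y / Real.sqrt (m t ^ 2 - y ^ 2)) y := by
    intro y hy t ht
    have := ((hasDerivAt_pow 2 y).const_sub (m t ^ 2)).sqrt (hpos y hy t ht).ne'
    refine this.congr_deriv ?_
    simp; field_simp
  constructor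
  · refine (hasDerivAt_param (fun y t => 1 / (m t * Real.sqrt (m t ^ 2 - y ^ 2)))
      (fun y t => y / (m t * Real.sqrt (m t ^ 2 - y ^ 2) ^ 3)) 0 a ha 0 c ν hν
      ?_ ?_ ?_).differentiableAt
    · intro y hy
      refine ContinuousOn.div (by fun_prop) (by fun_prop) fun t ht => ?_
      exact (mul_pos (hmpos t) (Real.sqrt_pos.2 (hpos y hy t ht))).ne'
    · intro y hy t ht
      have hs := Real.sqrt_pos.2 (hpos y hy t ht)
      have h1 := (((hS y hy t ht).const_mul (m t)).inv (mul_pos (hmpos t) hs).ne')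
      simp only [one_div]
      refine HasDerivAt.congr_deriv h1 ?_
      have := hmpos t
      field_simp
    · refine ContinuousOn.div (by fun_prop) (by fun_prop) fun q hq => ?_
      exact (mul_pos (hmpos _) (pow_pos (Real.sqrt_pos.2 (hpos _ hq.1 _ hq.2)) 3)).ne'
  · have := (hasDerivAt_param (fun y t => Real.sqrt (m t ^ 2 - y ^ 2) / m t)
      (fun y t => -y * (1 / (m t * Real.sqrt (m t ^ 2 - y ^ 2)))) 0 a ha 0 c ν hν
      ?_ ?_ ?_)
    · rwa [intervalIntegral.integral_const_mul] at this
    · intro y hy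
      exact ContinuousOn.div (by fun_prop) (by fun_prop) fun t ht => (hmpos t).ne'
    · intro y hy t ht
      have hs := Real.sqrt_pos.2 (hpos y hy t ht)
      refine ((hS y hy t ht).div_const (m t)).congr_deriv ?_
      have := hmpos t
      field_simp
    · refine ContinuousOn.mul (by fun_prop) (ContinuousOn.div (by fun_prop) (by fun_prop) fun q hq => ?_)
      exact (mul_pos (hmpos _) (Real.sqrt_pos.2 (hpos _ hq.1 _ hq.2))).ne'

lemma struct_part (m : ℝ → ℝ) (hm : ContDiff ℝ (⊤:ℕ∞) m) (hmpos : ∀ t, 0 < m t)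
    (hmeven : ∀ t, m (-t) = m t)
    (hK0 : 0 < gaussK m 0) (hKdec : AntitoneOn (gaussK m) (Ici 0)) (ν : ℝ)
    (hν : ν ∈ Ioo (infm m) (m 0)) :
    ∃ b > 0, m b < ν ∧ ∀ t ∈ Ioc 0 b, deriv m t < 0 := by
  have hmc : Continuous m := hm.continuous
  have hmd : Differentiable ℝ m := hm.differentiable (by simp)
  have hm1 : ContDiff ℝ 1 (deriv m) := by
    have : ContDiff ℝ 2 m := contDiff_infty.1 hm 2
    exact this.deriv' (n := 1)
  have hm1d : Differentiable ℝ (deriv m) := hm1.differentiable (by simp)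
  have hm2c : Continuous (deriv (deriv m)) := hm1.continuous_deriv (by simp)
  have hKm : ∀ t, deriv (deriv m) t = - (gaussK m t * m t) := by
    intro t
    have := (hmpos t).ne'
    unfold gaussK; field_simp
  have hd0 : deriv m 0 = 0 := by
    have h1 := (hmd (-0)).hasDerivAt.scomp (0:ℝ) (hasDerivAt_neg (0:ℝ))
    have h2 : m ∘ (fun x => -x) = m := by ext t; exact hmeven t
    have h3 : HasDerivAt m ((-1:ℝ) • deriv m (-0)) 0 := by
      have h4 : (m ∘ Neg.neg) = m := h2
      rw [h4] at h1; exact h1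
    have := h3.deriv
    simp at this
    linarith
  obtain ⟨t1, ht1, ht1'⟩ : ∃ t1 > 0, m t1 < ν := by
    obtain ⟨t, ht⟩ := exists_lt_of_ciInf_lt hν.1
    have hne : t ≠ 0 := by rintro rfl; exact absurd ht hν.2.le.not_gt
    rcases lt_or_gt_of_ne hne with h | h
    · exact ⟨-t, by linarith, by rwa [hmeven]⟩
    · exact ⟨t, h, ht⟩
  obtain ⟨n, hn1, hn2⟩ := exists_between ht1'
  have hn0 : n < m 0 := hn2.trans hν.2
  have hS : IsCompact (Icc 0 t1 ∩ m ⁻¹' {n}) :=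
    isCompact_Icc.inter_right (isClosed_singleton.preimage hmc)
  have hSn : (Icc 0 t1 ∩ m ⁻¹' {n}).Nonempty := by
    obtain ⟨t, ht, htn⟩ := intermediate_value_Icc' ht1.le hmc.continuousOn
      (show n ∈ Icc (m t1) (m 0) from ⟨hn1.le, hn0.le⟩)
    exact ⟨t, ht, htn⟩
  obtain ⟨b, ⟨hb, hbn⟩, hbl⟩ := hS.exists_isLeast hSn
  have hbn : m b = n := hbn
  have hb0 : 0 < b := by
    rcases hb.1.eq_or_lt with h | h
    · rw [← h] at hbn; exact absurd hbn hn0.ne'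
    · exact h
  have hge : ∀ t ∈ Icc 0 b, n ≤ m t := by
    intro t ht
    by_contra! hlt
    obtain ⟨u, hu, hun⟩ := intermediate_value_Icc' ht.1 hmc.continuousOn
      (show n ∈ Icc (m t) (m 0) from ⟨hlt.le, hn0.le⟩)
    have h1 := hbl ⟨⟨hu.1, hu.2.trans (ht.2.trans hb.2)⟩, hun⟩
    have h2 : t = b := le_antisymm ht.2 (h1.trans hu.2)
    rw [h2, hbn] at hlt
    exact lt_irrefl _ hlt
  refine ⟨b, hb0, hbn ▸ hn2, ?_⟩
  intro τ hτ
  by_contra! hneg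
  rcases le_or_gt 0 (gaussK m τ) with hK | hK
  · -- concave up to τ
    have hanti : AntitoneOn (deriv m) (Icc 0 τ) := by
      refine antitoneOn_of_deriv_nonpos (convex_Icc 0 τ) hm1.continuous.continuousOn
        hm1d.differentiableOn fun x hx => ?_
      rw [interior_Icc] at hx
      rw [hKm]
      have : gaussK m τ ≤ gaussK m x := hKdec hx.1.le hτ.1.le hx.2.le
      have := mul_nonneg (hK.trans this) (hmpos x).le
      linarith
    have hneg0 : deriv (deriv m) 0 < 0 := by
      rw [hKm]; have := mul_pos hK0 (hmpos 0); linarith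
    have hz : ∀ t ∈ Icc 0 τ, deriv m t = 0 := by
      intro t ht
      have h1 := hanti ⟨le_rfl, hτ.1.le⟩ ht ht.1
      have h2 := hanti ht ⟨hτ.1.le, le_rfl⟩ ht.2
      rw [hd0] at h1
      linarith
    have hev : ∀ᶠ t in nhds (0:ℝ), deriv (deriv m) t < 0 :=
      hm2c.continuousAt.eventually_lt continuousAt_const hneg0
    obtain ⟨ε, hε, hball⟩ := Metric.eventually_nhds_iff.1 hev
    set e := min (ε / 2) τ with he
    have hepos : 0 < e := lt_min (by linarith) hτ.1
    have hsa : StrictAntiOn (deriv m) (Icc 0 e) := by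
      refine strictAntiOn_of_deriv_neg (convex_Icc 0 e) hm1.continuous.continuousOn fun x hx => ?_
      rw [interior_Icc] at hx
      apply hball
      rw [Real.dist_eq, sub_zero, abs_of_pos hx.1]
      have : e ≤ ε / 2 := min_le_left _ _
      linarith [hx.2]
    have h1 := hsa ⟨le_rfl, hepos.le⟩ ⟨hepos.le, le_rfl⟩ hepos
    rw [hd0, hz e ⟨hepos.le, min_le_right _ _⟩] at h1
    exact lt_irrefl _ h1
  · have hmono : MonotoneOn (deriv m) (Ici τ) := by
      refine monotoneOn_of_deriv_nonneg (convex_Ici τ) hm1.continuous.continuousOn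
        hm1d.differentiableOn fun x hx => ?_
      rw [interior_Ici] at hx
      rw [hKm]
      have : gaussK m x ≤ gaussK m τ := hKdec hτ.1.le (hτ.1.trans hx).le (le_of_lt hx)
      have := mul_nonneg (neg_nonneg.2 (this.trans hK.le)) (hmpos x).le
      linarith
    have hmono2 : MonotoneOn m (Ici τ) := by
      refine monotoneOn_of_deriv_nonneg (convex_Ici τ) hmc.continuousOn
        hmd.differentiableOn fun x hx => ?_
      rw [interior_Ici] at hx
      exact hneg.trans (hmono self_mem_Ici (Ioi_subset_Ici_self hx) (le_of_lt hx))
    have h1 := hmono2 self_mem_Ici (show t1 ∈ Ici τ from hτ.2.trans hb.2) (hτ.2.trans hb.2)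
    have h2 := hge τ ⟨hτ.1.le, hτ.2⟩
    linarith

/-- Inverse of `m` on `[0,b]`. -/
lemma inverse_part (m : ℝ → ℝ) (hm : ContDiff ℝ (⊤:ℕ∞) m)
    (b : ℝ) (hb : 0 < b) (hneg : ∀ t ∈ Ioc 0 b, deriv m t < 0) :
    ∃ T : ℝ → ℝ, StrictAntiOn m (Icc 0 b) ∧
      (∀ s ∈ Ioo (m b) (m 0), T s ∈ Ioo 0 b ∧ m (T s) = s) ∧
      (∀ t ∈ Ioo 0 b, T (m t) = t) ∧
      ∀ s ∈ Ioo (m b) (m 0), HasDerivAt T (deriv m (T s))⁻¹ s := by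
  have hmc : Continuous m := hm.continuous
  have hmd : Differentiable ℝ m := hm.differentiable (by simp)
  have hsa : StrictAntiOn m (Icc 0 b) := by
    refine strictAntiOn_of_deriv_neg (convex_Icc 0 b) hmc.continuousOn fun x hx => ?_
    rw [interior_Icc] at hx
    exact hneg x ⟨hx.1, hx.2.le⟩
  have hex : ∀ s, ∃ t, s ∈ Ioo (m b) (m 0) → t ∈ Ioo 0 b ∧ m t = s := by
    intro s
    by_cases hs : s ∈ Ioo (m b) (m 0)
    · obtain ⟨t, ht, hts⟩ := intermediate_value_Ioo' hb.le hmc.continuousOn hs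
      exact ⟨t, fun _ => ⟨ht, hts⟩⟩
    · exact ⟨0, fun h => absurd h hs⟩
  choose T hT using hex
  have hmem : ∀ t ∈ Ioo 0 b, m t ∈ Ioo (m b) (m 0) := fun t ht =>
    ⟨hsa (Ioo_subset_Icc_self ht) ⟨hb.le, le_rfl⟩ ht.2,
      hsa ⟨le_rfl, hb.le⟩ (Ioo_subset_Icc_self ht) ht.1⟩
  have hleft : ∀ t ∈ Ioo 0 b, T (m t) = t := fun t ht =>
    hsa.injOn (Ioo_subset_Icc_self (hT _ (hmem t ht)).1) (Ioo_subset_Icc_self ht)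
      (hT _ (hmem t ht)).2
  refine ⟨T, hsa, hT, hleft, ?_⟩
  intro s hs
  obtain ⟨h1, h2⟩ := hT s hs
  have hnhds : Ioo (m b) (m 0) ∈ nhds s := Ioo_mem_nhds hs.1 hs.2
  have hcont : ContinuousAt T s := by
    refine tendsto_order.2 ⟨fun u hu => ?_, fun u hu => ?_⟩
    · obtain ⟨v, hv1, hv2⟩ := exists_between (max_lt hu h1.1)
      have hv : v ∈ Ioo 0 b := ⟨(le_max_right _ _).trans_lt hv1, hv2.trans h1.2⟩
      have hsv : s < m v := by
        rw [← h2]; exact hsa (Ioo_subset_Icc_self hv) (Ioo_subset_Icc_self h1) hv2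
      filter_upwards [hnhds, Iio_mem_nhds hsv] with y hy hyv
      have hy' := hT y hy
      have : v < T y := by
        rw [← hsa.lt_iff_gt (Ioo_subset_Icc_self hy'.1) (Ioo_subset_Icc_self hv), hy'.2]
        exact hyv
      exact ((le_max_left _ _).trans_lt hv1).trans this
    · obtain ⟨v, hv1, hv2⟩ := exists_between (lt_min hu h1.2)
      have hv : v ∈ Ioo 0 b := ⟨h1.1.trans hv1, hv2.trans_le (min_le_right _ _)⟩
      have hsv : m v < s := by
        rw [← h2]; exact hsa (Ioo_subset_Icc_self h1) (Ioo_subset_Icc_self hv) hv1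
      filter_upwards [hnhds, Ioi_mem_nhds hsv] with y hy hyv
      have hy' := hT y hy
      have : T y < v := by
        rw [← hsa.lt_iff_gt (Ioo_subset_Icc_self hv) (Ioo_subset_Icc_self hy'.1), hy'.2]
        exact hyv
      exact this.trans (hv2.trans_le (min_le_left _ _))
  refine HasDerivAt.of_local_left_inverse hcont (hmd _).hasDerivAt
    (hneg _ ⟨h1.1, h1.2.le⟩).ne ?_
  filter_upwards [hnhds] with y hy using (hT y hy).2

lemma xi_eq (m : ℝ → ℝ) (b t : ℝ) (hsa : StrictAntiOn m (Icc 0 b)) (ht : t ∈ Ioo 0 b) :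
    xi m (m t) = t := by
  have : IsLeast {u : ℝ | 0 < u ∧ m u = m t} t := by
    refine ⟨⟨ht.1, rfl⟩, fun u hu => ?_⟩
    by_contra! hlt
    have := hsa ⟨hu.1.le, (hlt.trans ht.2).le⟩ (Ioo_subset_Icc_self ht) hlt
    exact this.ne' hu.2
  exact this.csInf_eq

/-- Change of variables. -/
lemma change_var (m T : ℝ → ℝ)
    (a b ν : ℝ) (ha : a ∈ Ioo 0 b) (hmb : 0 < m b)
    (hneg : ∀ t ∈ Ioc 0 b, deriv m t < 0) (hsa : StrictAntiOn m (Icc 0 b))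
    (hT : ∀ s ∈ Ioo (m b) (m 0), T s ∈ Ioo 0 b ∧ m (T s) = s)
    (hTl : ∀ t ∈ Ioo 0 b, T (m t) = t)
    (hTd : ∀ s ∈ Ioo (m b) (m 0), HasDerivAt T (deriv m (T s))⁻¹ s)
    (hν : ν ∈ Ioo (m b) (m a)) (f g : ℝ → ℝ)
    (hg : ContinuousOn g (Icc 0 1))
    (hfg : ∀ x ∈ Ioo (0:ℝ) 1, - (deriv m (T (sfun (m a) ν x)))⁻¹ *
      (((m a) ^ 2 - ν ^ 2) * x / sfun (m a) ν x) * f (T (sfun (m a) ν x)) = g x) :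
    IntervalIntegrable f MeasureTheory.volume a (T ν) ∧
      ∫ t in a..(T ν), f t = ∫ x in (0:ℝ)..1, g x := by
  set c := m a with hc
  have hν0 : 0 < ν := hmb.trans hν.1
  have hb : 0 < b := ha.1.trans ha.2
  have hcm : c < m 0 := hsa ⟨le_rfl, hb.le⟩ (Ioo_subset_Icc_self ha) ha.1
  have hνI : ν ∈ Ioo (m b) (m 0) := ⟨hν.1, hν.2.trans hcm⟩
  have hTν := hT ν hνI
  have haT : a < T ν := by
    rw [← hsa.lt_iff_gt (Ioo_subset_Icc_self hTν.1) (Ioo_subset_Icc_self ha), hTν.2]; exact hν.2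
  have hs : ∀ x ∈ Icc (0:ℝ) 1, sfun c ν x ∈ Ioo (m b) (m 0) := fun x hx => by
    have := sfun_mem hν0 hν.2 hx
    exact ⟨hν.1.trans_le this.1, this.2.trans_lt hcm⟩
  have hR0 : 0 < c ^ 2 - ν ^ 2 := by nlinarith [hν.2]
  have hder : ∀ x ∈ Ioo (0:ℝ) 1, HasDerivWithinAt (fun x => T (sfun c ν x))
      ((deriv m (T (sfun c ν x)))⁻¹ * ((c ^ 2 - ν ^ 2) * x / sfun c ν x)) (Ioo 0 1) x := by
    intro x hx
    have hx' := Ioo_subset_Icc_self hx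
    exact ((hTd _ (hs x hx')).comp x (sfun_deriv_x hν0 hν.2 hx')).hasDerivWithinAt
  have hinj : InjOn (fun x => T (sfun c ν x)) (Ioo 0 1) := by
    intro x hx y hy hxy
    have hx' := Ioo_subset_Icc_self hx
    have hy' := Ioo_subset_Icc_self hy
    have h1 : sfun c ν x = sfun c ν y := by
      rw [← (hT _ (hs x hx')).2, ← (hT _ (hs y hy')).2]; exact congrArg m hxy
    have h2 : sfun c ν x ^ 2 = sfun c ν y ^ 2 := by rw [h1]
    rw [sfun_sq hν0 hν.2 hx', sfun_sq hν0 hν.2 hy'] at h2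
    have h3 : (c ^ 2 - ν ^ 2) * (x ^ 2 - y ^ 2) = 0 := by linarith
    have h4 : x ^ 2 = y ^ 2 := by
      rcases mul_eq_zero.1 h3 with h | h
      · exact absurd h hR0.ne'
      · linarith
    exact (pow_left_inj₀ hx.1.le hy.1.le two_ne_zero).1 h4
  have himg : (fun x => T (sfun c ν x)) '' (Ioo 0 1) = Ioo a (T ν) := by
    ext t
    constructor
    · rintro ⟨x, hx, rfl⟩
      have hx' := Ioo_subset_Icc_self hx
      have h1 := hT _ (hs x hx')
      have hsq := sfun_sq hν0 hν.2 hx'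
      have hsp : 0 < sfun c ν x := hmb.trans (hs x hx').1
      have hx2 : 0 < x ^ 2 := pow_pos hx.1 2
      have hx3 : x ^ 2 < 1 := by nlinarith [hx.1, hx.2]
      have hlt1 : ν < sfun c ν x := by
        refine lt_of_pow_lt_pow_left₀ 2 hsp.le ?_
        rw [hsq]; nlinarith [mul_pos hR0 hx2]
      have hlt2 : sfun c ν x < c := by
        refine lt_of_pow_lt_pow_left₀ 2 (hν0.trans hν.2).le ?_
        rw [hsq]; nlinarith [mul_pos hR0 (sub_pos.2 hx3)]
      constructor
      · show a < T (sfun c ν x)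
        rw [← hsa.lt_iff_gt (Ioo_subset_Icc_self h1.1) (Ioo_subset_Icc_self ha), h1.2]; exact hlt2
      · show T (sfun c ν x) < T ν
        rw [← hsa.lt_iff_gt (Ioo_subset_Icc_self hTν.1) (Ioo_subset_Icc_self h1.1), h1.2, hTν.2]
        exact hlt1
    · intro ht
      have htI : t ∈ Ioo 0 b := ⟨ha.1.trans ht.1, ht.2.trans hTν.1.2⟩
      have h1 : m t < c := hsa (Ioo_subset_Icc_self ha) (Ioo_subset_Icc_self htI) ht.1
      have h2 : ν < m t := by
        rw [← hTν.2]; exact hsa (Ioo_subset_Icc_self htI) (Ioo_subset_Icc_self hTν.1) ht.2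
      have h3 : 0 < (m t ^ 2 - ν ^ 2) / (c ^ 2 - ν ^ 2) := by
        apply div_pos _ hR0; nlinarith
      have h4 : (m t ^ 2 - ν ^ 2) / (c ^ 2 - ν ^ 2) < 1 := by
        rw [div_lt_one hR0]; nlinarith
      refine ⟨Real.sqrt ((m t ^ 2 - ν ^ 2) / (c ^ 2 - ν ^ 2)), ⟨Real.sqrt_pos.2 h3, ?_⟩, ?_⟩
      · rw [Real.sqrt_lt' one_pos]; simpa using h4
      · have : sfun c ν (Real.sqrt ((m t ^ 2 - ν ^ 2) / (c ^ 2 - ν ^ 2))) = m t := by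
          unfold sfun
          rw [Real.sq_sqrt h3.le]
          have : ν ^ 2 * (1 - (m t ^ 2 - ν ^ 2) / (c ^ 2 - ν ^ 2)) +
            c ^ 2 * ((m t ^ 2 - ν ^ 2) / (c ^ 2 - ν ^ 2)) = m t ^ 2 := by
            have := hR0.ne'
            field_simp; ring
          rw [this, Real.sqrt_sq (hν0.trans h2).le]
        show T _ = t
        rw [this]; exact hTl t htI
  have hEq : EqOn (fun x => |(deriv m (T (sfun c ν x)))⁻¹ * ((c ^ 2 - ν ^ 2) * x / sfun c ν x)| •
      f (T (sfun c ν x))) g (Ioo 0 1) := by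
    intro x hx
    have hx' := Ioo_subset_Icc_self hx
    have h1 := hT _ (hs x hx')
    have hsp : 0 < sfun c ν x := hmb.trans (hs x hx').1
    have h2 : (deriv m (T (sfun c ν x)))⁻¹ < 0 := inv_lt_zero.2 (hneg _ ⟨h1.1.1, h1.1.2.le⟩)
    have h3 : 0 < (c ^ 2 - ν ^ 2) * x / sfun c ν x := div_pos (mul_pos hR0 hx.1) hsp
    simp only [smul_eq_mul]
    rw [← hfg x hx, abs_mul, abs_of_neg h2, abs_of_pos h3]
  have hgi : MeasureTheory.IntegrableOn g (Ioo 0 1) :=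
    (hg.integrableOn_Icc).mono_set Ioo_subset_Icc_self
  constructor
  · rw [intervalIntegrable_iff_integrableOn_Ioo_of_le haT.le, ← himg,
      MeasureTheory.integrableOn_image_iff_integrableOn_abs_deriv_smul measurableSet_Ioo hder hinj]
    exact hgi.congr_fun hEq.symm measurableSet_Ioo
  · rw [intervalIntegral.integral_of_le haT.le, intervalIntegral.integral_of_le zero_le_one,
      MeasureTheory.integral_Ioc_eq_integral_Ioo, MeasureTheory.integral_Ioc_eq_integral_Ioo,
      ← himg, MeasureTheory.integral_image_eq_integral_abs_deriv_smul measurableSet_Ioo hder hinj]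
    exact MeasureTheory.setIntegral_congr_fun measurableSet_Ioo hEq

/-- `l` is differentiable on `(inf m, m 0)` with `l'(ν) = ν φ'(ν)`. -/
theorem stmt6 (m : ℝ → ℝ) (hm : ContDiff ℝ (⊤:ℕ∞) m) (hmpos : ∀ t, 0 < m t)
    (hmeven : ∀ t, m (-t) = m t)
    (hK0 : 0 < gaussK m 0) (hKdec : AntitoneOn (gaussK m) (Ici 0)) :
    ∀ ν ∈ Ioo (infm m) (m 0),
      DifferentiableAt ℝ (ell m) ν ∧ deriv (ell m) ν = ν * deriv (phi m) ν := by
  intro ν₀ hν₀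
  have hmc : Continuous m := hm.continuous
  have hmd : Differentiable ℝ m := hm.differentiable (by simp)
  have hm1 : ContDiff ℝ 1 (deriv m) := by
    have : ContDiff ℝ 2 m := contDiff_infty.1 hm 2
    exact this.deriv' (n := 1)
  have hm1d : Differentiable ℝ (deriv m) := hm1.differentiable (by simp)
  have hm2c : Continuous (deriv (deriv m)) := hm1.continuous_deriv (by simp)
  obtain ⟨b, hb, hbν, hneg⟩ := struct_part m hm hmpos hmeven hK0 hKdec ν₀ hν₀
  obtain ⟨T, hsa, hT, hTl, hTd⟩ := inverse_part m hm b hb hneg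
  obtain ⟨c, hc1, hc2⟩ := exists_between hν₀.2
  obtain ⟨ha, hac⟩ := hT c ⟨hbν.trans hc1, hc2⟩
  set a := T c with hadef
  set p : ℝ → ℝ := fun s => -(deriv m (T s) * s ^ 2)⁻¹ with hpdef
  set p' : ℝ → ℝ := fun s => (deriv (deriv m) (T s) * (deriv m (T s))⁻¹ * s ^ 2 +
    deriv m (T s) * (2 * s)) / (deriv m (T s) * s ^ 2) ^ 2 with hp'def
  have hmb := hmpos b
  have hdne : ∀ s ∈ Ioo (m b) (m 0), deriv m (T s) ≠ 0 := fun s hs =>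
    (hneg _ ⟨(hT s hs).1.1, (hT s hs).1.2.le⟩).ne
  have hsne : ∀ s ∈ Ioo (m b) (m 0), s ≠ 0 := fun s hs => (hmb.trans hs.1).ne'
  have hTc : ContinuousOn T (Ioo (m b) (m 0)) := fun s hs =>
    (hTd s hs).continuousAt.continuousWithinAt
  have hp : ∀ s ∈ Ioo (m b) (m 0), HasDerivAt p (p' s) s := by
    intro s hs
    have h1 := hdne s hs
    have h2 := hsne s hs
    have h3 := ((hm1d (T s)).hasDerivAt.comp s (hTd s hs)).fun_mul (hasDerivAt_pow 2 s)
    have h4 := (h3.fun_inv (mul_ne_zero h1 (pow_ne_zero 2 h2))).fun_neg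
    refine HasDerivAt.congr_deriv h4 ?_
    simp only [hp'def, Function.comp_apply]
    push_cast
    ring
  have hp' : ContinuousOn p' (Ioo (m b) (m 0)) := by
    have e1 : ContinuousOn (fun s => deriv m (T s)) (Ioo (m b) (m 0)) :=
      hm1.continuous.comp_continuousOn hTc
    have e2 : ContinuousOn (fun s => deriv (deriv m) (T s)) (Ioo (m b) (m 0)) :=
      hm2c.comp_continuousOn hTc
    refine ContinuousOn.div (((e2.mul (e1.inv₀ hdne)).mul (by fun_prop)).add
      (e1.mul (by fun_prop))) ((e1.mul (by fun_prop)).pow 2) fun s hs => ?_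
    exact pow_ne_zero 2 (mul_ne_zero (hdne s hs) (pow_ne_zero 2 (hsne s hs)))
  have hac' : ∀ t ∈ Icc 0 a, c ≤ m t := fun t ht => by
    rw [← hac]
    exact hsa.antitoneOn ⟨ht.1, ht.2.trans ha.2.le⟩ (Ioo_subset_Icc_self ha) ht.2
  have hν₀I : ν₀ ∈ Ioo (m b) c := ⟨hbν, hc1⟩
  obtain ⟨hN1, hN2⟩ := near_part p p' (m b) (m 0) c ν₀ hmb hc2 hν₀I hp hp'
  obtain ⟨hF1, hF2⟩ := far_part m hmc hmpos a c ν₀ ha.1.le hac' ⟨hmb.trans hbν, hc1⟩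
  have hpc : ContinuousOn p (Ioo (m b) (m 0)) := fun s hs => (hp s hs).continuousAt.continuousWithinAt
  have hform : ∀ ν ∈ Ioo (m b) c,
      phi m ν = 2 * (ν * ((∫ t in (0:ℝ)..a, 1 / (m t * Real.sqrt (m t ^ 2 - ν ^ 2))) +
        Real.sqrt (c ^ 2 - ν ^ 2) * ∫ x in (0:ℝ)..1, p (sfun c ν x))) ∧
      ell m ν = ν * phi m ν + 2 * ((∫ t in (0:ℝ)..a, Real.sqrt (m t ^ 2 - ν ^ 2) / m t) +
        Real.sqrt (c ^ 2 - ν ^ 2) ^ 3 * ∫ x in (0:ℝ)..1, x ^ 2 * p (sfun c ν x)) := by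
    intro ν hν
    have hν0 : 0 < ν := hmb.trans hν.1
    have hνI : ν ∈ Ioo (m b) (m 0) := ⟨hν.1, hν.2.trans hc2⟩
    have hxi : xi m ν = T ν := by
      have := xi_eq m b (T ν) hsa (hT ν hνI).1
      rwa [(hT ν hνI).2] at this
    have hR0 : 0 < c ^ 2 - ν ^ 2 := by nlinarith [hν.2]
    have hRp := Real.sqrt_pos.2 hR0
    have hRsq := Real.sq_sqrt hR0.le
    set R := Real.sqrt (c ^ 2 - ν ^ 2) with hRdef
    have hs : ∀ x ∈ Icc (0:ℝ) 1, sfun c ν x ∈ Ioo (m b) (m 0) := fun x hx => by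
      have := sfun_mem hν0 hν.2 hx
      exact ⟨hν.1.trans_le this.1, this.2.trans_lt hc2⟩
    have hsc : Continuous (fun x => sfun c ν x) :=
      (sfun_cont c).comp (by fun_prop : Continuous fun x : ℝ => (ν, x))
    have hpx : ContinuousOn (fun x => p (sfun c ν x)) (Icc 0 1) :=
      hpc.comp hsc.continuousOn hs
    have hsqx : ∀ x ∈ Icc (0:ℝ) 1, Real.sqrt (sfun c ν x ^ 2 - ν ^ 2) = R * x := by
      intro x hx
      rw [sfun_sq hν0 hν.2 hx]
      have : ν ^ 2 * (1 - x ^ 2) + c ^ 2 * x ^ 2 - ν ^ 2 = (R * x) ^ 2 := by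
        rw [mul_pow, hRsq]; ring
      rw [this, Real.sqrt_sq (mul_nonneg hRp.le hx.1)]
    have hfar : ∀ t ∈ Icc 0 a, 0 < m t ^ 2 - ν ^ 2 := by
      intro t ht
      have := hac' t ht
      nlinarith [hν.2]
    have hiF1 : IntervalIntegrable (fun t => 1 / (m t * Real.sqrt (m t ^ 2 - ν ^ 2)))
        MeasureTheory.volume 0 a := by
      apply ContinuousOn.intervalIntegrable
      rw [uIcc_of_le ha.1.le]
      refine ContinuousOn.div (by fun_prop) (by fun_prop) fun t ht => ?_
      exact (mul_pos (hmpos t) (Real.sqrt_pos.2 (hfar t ht))).ne'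
    have hiF2 : IntervalIntegrable (fun t => Real.sqrt (m t ^ 2 - ν ^ 2) / m t)
        MeasureTheory.volume 0 a := by
      apply ContinuousOn.intervalIntegrable
      exact ContinuousOn.div (by fun_prop) (by fun_prop) fun t ht => (hmpos t).ne'
    have hiN1 : IntervalIntegrable (fun x => p (sfun c ν x)) MeasureTheory.volume 0 1 := by
      apply ContinuousOn.intervalIntegrable
      rw [uIcc_of_le zero_le_one]; exact hpx
    have hiN2 : IntervalIntegrable (fun x => x ^ 2 * p (sfun c ν x)) MeasureTheory.volume 0 1 := by
      apply ContinuousOn.intervalIntegrable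
      rw [uIcc_of_le zero_le_one]; exact ContinuousOn.mul (by fun_prop) hpx
    obtain ⟨hc1i, hc1e⟩ := change_var m T a b ν ha hmb hneg hsa hT hTl hTd (by rwa [hac])
      (fun t => 1 / (m t * Real.sqrt (m t ^ 2 - ν ^ 2))) (fun x => R * p (sfun c ν x))
      (continuousOn_const.mul hpx) (by
        intro x hx
        have hx' := Ioo_subset_Icc_self hx
        rw [hac]
        simp only [(hT _ (hs x hx')).2, hsqx x hx', hpdef, ← hRsq]
        have h1 := hdne _ (hs x hx')
        have h2 := hsne _ (hs x hx')
        have h3 := hx.1.ne'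
        field_simp)
    obtain ⟨hc2i, hc2e⟩ := change_var m T a b ν ha hmb hneg hsa hT hTl hTd (by rwa [hac])
      (fun t => Real.sqrt (m t ^ 2 - ν ^ 2) / m t) (fun x => R ^ 3 * (x ^ 2 * p (sfun c ν x)))
      (continuousOn_const.mul (ContinuousOn.mul (by fun_prop) hpx)) (by
        intro x hx
        have hx' := Ioo_subset_Icc_self hx
        rw [hac]
        simp only [(hT _ (hs x hx')).2, hsqx x hx', hpdef, ← hRsq]
        have h1 := hdne _ (hs x hx')
        have h2 := hsne _ (hs x hx')
        have h3 := hx.1.ne'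
        field_simp)
    rw [intervalIntegral.integral_const_mul] at hc1e hc2e
    have hA : ∫ t in (0:ℝ)..(T ν), 1 / (m t * Real.sqrt (m t ^ 2 - ν ^ 2)) =
        (∫ t in (0:ℝ)..a, 1 / (m t * Real.sqrt (m t ^ 2 - ν ^ 2))) +
        R * ∫ x in (0:ℝ)..1, p (sfun c ν x) := by
      rw [← intervalIntegral.integral_add_adjacent_intervals hiF1 hc1i, hc1e]
    have hB : ∫ t in (0:ℝ)..(T ν), Real.sqrt (m t ^ 2 - ν ^ 2) / m t =
        (∫ t in (0:ℝ)..a, Real.sqrt (m t ^ 2 - ν ^ 2) / m t) +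
        R ^ 3 * ∫ x in (0:ℝ)..1, x ^ 2 * p (sfun c ν x) := by
      rw [← intervalIntegral.integral_add_adjacent_intervals hiF2 hc2i, hc2e]
    have hphi : phi m ν = 2 * (ν * ∫ t in (0:ℝ)..(T ν), 1 / (m t * Real.sqrt (m t ^ 2 - ν ^ 2))) := by
      unfold phi
      rw [hxi, ← intervalIntegral.integral_const_mul ν]
      congr 2
      ext t
      ring
    refine ⟨by rw [hphi, hA], ?_⟩
    rw [← hB, hphi]
    have hell : ell m ν = 2 * ∫ t in (0:ℝ)..(T ν), m t / Real.sqrt (m t ^ 2 - ν ^ 2) := by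
      unfold ell
      rw [hxi]
      have := intervalIntegral.integral_comp_neg (a := 0) (b := T ν)
        (fun t => m t / Real.sqrt (m t ^ 2 - ν ^ 2))
      simp only [hmeven, neg_zero] at this
      rw [this]
    have hpt : ∀ t, m t / Real.sqrt (m t ^ 2 - ν ^ 2) =
        ν ^ 2 * (1 / (m t * Real.sqrt (m t ^ 2 - ν ^ 2))) + Real.sqrt (m t ^ 2 - ν ^ 2) / m t := by
      intro t
      have h1 := hmpos t
      rcases le_or_gt (m t ^ 2 - ν ^ 2) 0 with h | h
      · simp [Real.sqrt_eq_zero'.2 h]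
      · have h2 := Real.sqrt_pos.2 h
        have h3 := Real.sq_sqrt h.le
        field_simp
        rw [h3]; ring
    rw [hell]
    simp_rw [hpt]
    rw [intervalIntegral.integral_add ((hiF1.trans hc1i).const_mul _) (hiF2.trans hc2i),
      intervalIntegral.integral_const_mul]
    ring
  have hnh : Ioo (m b) c ∈ nhds ν₀ := Ioo_mem_nhds hbν hc1
  have hphid : DifferentiableAt ℝ (phi m) ν₀ := by
    have h1 := (differentiableAt_id.fun_mul (hF1.fun_add hN1)).const_mul (2:ℝ)
    refine h1.congr_of_eventuallyEq ?_
    filter_upwards [hnh] with ν hν using (hform ν hν).1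
  have hder : HasDerivAt (ell m) (ν₀ * deriv (phi m) ν₀) ν₀ := by
    have h1 := ((hasDerivAt_id' ν₀).fun_mul hphid.hasDerivAt).fun_add
      ((hF2.fun_add hN2).const_mul (2:ℝ))
    have h2 := h1.congr_of_eventuallyEq (f₁ := ell m) (by
      filter_upwards [hnh] with ν hν using (hform ν hν).2)
    refine h2.congr_deriv ?_
    rw [(hform ν₀ hν₀I).1]
    ring
  exact ⟨hder.differentiableAt, hder.deriv⟩
end
end

section
/- Let p̃ ∈ M̃, let α and β be unit-speed minimal geodesic segments from p̃ to a common cut point y bounding a sector D(α, β), and let γ : [0, L(γ)] → M̃ be a unit-speed minimal geodesic segment joining p̃ to an end point x of C_p̃ lying in D(α, β), with L(γ) ≤ L(α) = L(β). Assume the initial angles satisfy ∠(α'(0), ∂/∂t) < ∠(γ'(0), ∂/∂t) < ∠(β'(0), ∂/∂t). Then t(α(s)) ≥ t(γ(s)) ≥ t(β(s)) for every s ∈ [0, L(γ)]. -/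
open Real Set

noncomputable section

/-- `Γ_x`: the set of all points lying on some minimal geodesic segment joining `p` to `x`. -/
def SegPoints (m : ℝ → ℝ) (p x : ℝ × ℝ) : Set (ℝ × ℝ) :=
  {z | ∃ γ : ℝ → ℝ × ℝ, ∃ a : ℝ, IsUnitGeodesic m γ ∧ γ 0 = p ∧ 0 < a ∧ γ a = x ∧
    IsMinimalSeg m γ a ∧ ∃ s ∈ Set.Icc (0:ℝ) a, γ s = z}

/-- A sector at the cut point `x` of `p`: a connected component of `M̃ \ Γ_x`. -/
def IsSector (m : ℝ → ℝ) (p x : ℝ × ℝ) (D : Set (ℝ × ℝ)) : Prop :=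
  ∃ z ∈ (SegPoints m p x)ᶜ, D = connectedComponentIn (SegPoints m p x)ᶜ z

/-- `x` is an end point of the cut locus of `p`: a cut point admitting exactly one sector. -/
def IsEndPoint (m : ℝ → ℝ) (p x : ℝ × ℝ) : Prop :=
  IsCutPoint m p x ∧ ∃! D : Set (ℝ × ℝ), IsSector m p x D

/-- `D` is a sector bounded by the two geodesic segments `α|[0,Lα]` and `β|[0,Lβ]`:
a connected component of the complement of their union. -/
def IsSectorOf (α β : ℝ → ℝ × ℝ) (Lα Lβ : ℝ) (D : Set (ℝ × ℝ)) : Prop :=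
  ∃ z ∈ (α '' Set.Icc 0 Lα ∪ β '' Set.Icc 0 Lβ)ᶜ,
    D = connectedComponentIn (α '' Set.Icc 0 Lα ∪ β '' Set.Icc 0 Lβ)ᶜ z

/-- `γ s₁` is conjugate to `γ 0` along the geodesic `γ`: there is a nontrivial solution `J`
of the Jacobi equation `J'' + K(t(s)) J = 0` with `J 0 = J s₁ = 0`. -/
def ConjugateAlong (m : ℝ → ℝ) (γ : ℝ → ℝ × ℝ) (s₁ : ℝ) : Prop :=
  ∃ J : ℝ → ℝ, ContDiff ℝ 2 J ∧
    (∀ s, deriv (deriv J) s + gaussK m (γ s).1 * J s = 0) ∧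
    J 0 = 0 ∧ J s₁ = 0 ∧ J ≠ 0

/-- The speed of a curve. -/
def wSpeed (m : ℝ → ℝ) (c : ℝ → ℝ × ℝ) (s : ℝ) : ℝ :=
  Real.sqrt ((deriv (fun u => (c u).1) s) ^ 2 +
      (m (c s).1) ^ 2 * (deriv (fun u => (c u).2) s) ^ 2)

lemma wLength_eq (m : ℝ → ℝ) (c : ℝ → ℝ × ℝ) (a b : ℝ) :
    wLength m c a b = ∫ s in a..b, wSpeed m c s := rfl

lemma wSpeed_nonneg (m : ℝ → ℝ) (c : ℝ → ℝ × ℝ) (s : ℝ) : 0 ≤ wSpeed m c s :=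
  Real.sqrt_nonneg _

lemma wLength_nonneg (m : ℝ → ℝ) (c : ℝ → ℝ × ℝ) {b : ℝ} (hb : 0 ≤ b) :
    0 ≤ wLength m c 0 b := by
  rw [wLength_eq]
  exact intervalIntegral.integral_nonneg hb (fun s _ => wSpeed_nonneg m c s)

lemma wDist_le (m : ℝ → ℝ) (c : ℝ → ℝ × ℝ) {b : ℝ} (hb : 0 ≤ b) (hc : ContDiff ℝ 1 c) :
    wDist m (c 0) (c b) ≤ wLength m c 0 b := by
  apply csInf_le
  · refine ⟨0, ?_⟩
    rintro L ⟨c', b', hb', _, _, _, rfl⟩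
    exact wLength_nonneg m c' hb'
  · exact ⟨c, b, hb, hc, rfl, rfl, rfl⟩

lemma wSpeed_continuous {m : ℝ → ℝ} (hm : Continuous m) {c : ℝ → ℝ × ℝ}
    (hc : ContDiff ℝ 1 c) : Continuous (wSpeed m c) := by
  have h1 : Continuous (deriv fun u => (c u).1) := hc.fst.continuous_deriv le_rfl
  have h2 : Continuous (deriv fun u => (c u).2) := hc.snd.continuous_deriv le_rfl
  have h3 : Continuous c := hc.continuous
  unfold wSpeed
  fun_prop

/-- Speed after a monotone reparametrization. -/
lemma wSpeed_comp (m : ℝ → ℝ) {c : ℝ → ℝ × ℝ} (hc : ContDiff ℝ 1 c) {φ : ℝ → ℝ}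
    {s d : ℝ} (hφ : HasDerivAt φ d s) (hd : 0 ≤ d) :
    wSpeed m (fun u => c (φ u)) s = wSpeed m c (φ s) * d := by
  have d1 : DifferentiableAt ℝ (fun u => (c u).1) (φ s) :=
    (hc.fst.differentiable one_ne_zero) _
  have d2 : DifferentiableAt ℝ (fun u => (c u).2) (φ s) :=
    (hc.snd.differentiable one_ne_zero) _
  have e1 : deriv (fun u => (c (φ u)).1) s = deriv (fun u => (c u).1) (φ s) * d :=
    (d1.hasDerivAt.comp s hφ).deriv
  have e2 : deriv (fun u => (c (φ u)).2) s = deriv (fun u => (c u).2) (φ s) * d :=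
    (d2.hasDerivAt.comp s hφ).deriv
  unfold wSpeed
  rw [e1, e2, ← Real.sqrt_sq hd, ← Real.sqrt_mul' _ (sq_nonneg d), Real.sqrt_sq hd]
  congr 1
  ring

lemma wLength_comp {m : ℝ → ℝ} (hm : Continuous m) {c : ℝ → ℝ × ℝ} (hc : ContDiff ℝ 1 c)
    {φ : ℝ → ℝ} (hφ : ContDiff ℝ 1 φ) (hmono : Monotone φ) (a b : ℝ) :
    wLength m (fun u => c (φ u)) a b = wLength m c (φ a) (φ b) := by
  rw [wLength_eq, wLength_eq]
  have hd : ∀ s, HasDerivAt φ (deriv φ s) s := fun s =>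
    ((hφ.differentiable one_ne_zero) s).hasDerivAt
  rw [← intervalIntegral.integral_comp_mul_deriv (f := φ) (f' := deriv φ)
    (fun s _ => hd s) (hφ.continuous_deriv le_rfl).continuousOn (wSpeed_continuous hm hc)]
  apply intervalIntegral.integral_congr
  intro s _
  exact wSpeed_comp m hc (hd s) hmono.deriv_nonneg

lemma wSpeed_congr (m : ℝ → ℝ) {c c' : ℝ → ℝ × ℝ} {s : ℝ} (h : c =ᶠ[nhds s] c') :
    wSpeed m c s = wSpeed m c' s := by
  have h1 : (fun u => (c u).1) =ᶠ[nhds s] fun u => (c' u).1 := h.fun_comp Prod.fst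
  have h2 : (fun u => (c u).2) =ᶠ[nhds s] fun u => (c' u).2 := h.fun_comp Prod.snd
  unfold wSpeed
  rw [h1.deriv_eq, h2.deriv_eq, h.eq_of_nhds]

lemma wDist_triangle {m : ℝ → ℝ} (hm : Continuous m) {c₁ c₂ : ℝ → ℝ × ℝ} {b₁ b₂ : ℝ}
    (hb₁ : 0 ≤ b₁) (hb₂ : 0 ≤ b₂) (hc₁ : ContDiff ℝ 1 c₁) (hc₂ : ContDiff ℝ 1 c₂)
    (hq : c₁ b₁ = c₂ 0) :
    wDist m (c₁ 0) (c₂ b₂) ≤ wLength m c₁ 0 b₁ + wLength m c₂ 0 b₂ := by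
  set φ₁ : ℝ → ℝ := fun s => b₁ * Real.smoothTransition s with hφ₁
  set φ₂ : ℝ → ℝ := fun s => b₂ * Real.smoothTransition (s - 1) with hφ₂
  have st : ContDiff ℝ 1 Real.smoothTransition := Real.smoothTransition.contDiff
  have k₁ : ContDiff ℝ 1 φ₁ := contDiff_const.mul st
  have k₂ : ContDiff ℝ 1 φ₂ := contDiff_const.mul (st.comp (contDiff_id.sub contDiff_const))
  have smono : Monotone Real.smoothTransition := Real.smoothTransition.monotone
  have m₁ : Monotone φ₁ := fun x y h => mul_le_mul_of_nonneg_left (smono h) hb₁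
  have m₂ : Monotone φ₂ := fun x y h =>
    mul_le_mul_of_nonneg_left (smono (sub_le_sub_right h 1)) hb₂
  have z₁ : φ₁ 0 = 0 := by simp [hφ₁]
  have o₁ : ∀ s, 1 ≤ s → φ₁ s = b₁ := fun s hs => by
    simp [hφ₁, Real.smoothTransition.one_of_one_le hs]
  have z₂ : ∀ s, s ≤ 1 → φ₂ s = 0 := fun s hs => by
    simp [hφ₂, Real.smoothTransition.zero_of_nonpos (sub_nonpos.2 hs)]
  have o₂ : φ₂ 2 = b₂ := by norm_num [hφ₂]
  set c : ℝ → ℝ × ℝ := fun s => c₁ (φ₁ s) + c₂ (φ₂ s) - c₂ 0 with hcdef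
  have hc : ContDiff ℝ 1 c := ((hc₁.comp k₁).add (hc₂.comp k₂)).sub contDiff_const
  have e₁ : ∀ s, s ≤ 1 → c s = c₁ (φ₁ s) := fun s hs => by simp [hcdef, z₂ s hs]
  have e₂ : ∀ s, 1 ≤ s → c s = c₂ (φ₂ s) := fun s hs => by simp [hcdef, o₁ s hs, hq]
  have c0 : c 0 = c₁ 0 := by rw [e₁ 0 zero_le_one, z₁]
  have c2 : c 2 = c₂ b₂ := by rw [e₂ 2 one_le_two, o₂]
  have key : wLength m c 0 2 = wLength m c₁ 0 b₁ + wLength m c₂ 0 b₂ := by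
    have i : ∀ u v, IntervalIntegrable (wSpeed m c) MeasureTheory.volume u v := fun u v =>
      (wSpeed_continuous hm hc).intervalIntegrable u v
    have s1 : wLength m c 0 1 = wLength m c₁ 0 b₁ := by
      have := wLength_comp hm hc₁ k₁ m₁ 0 1
      rw [z₁, o₁ 1 le_rfl] at this
      rw [← this, wLength_eq, wLength_eq]
      apply intervalIntegral.integral_congr_Ioo_of_le zero_le_one
      intro s hs
      apply wSpeed_congr
      filter_upwards [Iio_mem_nhds hs.2] with u hu using e₁ u (le_of_lt hu)
    have s2 : wLength m c 1 2 = wLength m c₂ 0 b₂ := by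
      have := wLength_comp hm hc₂ k₂ m₂ 1 2
      rw [z₂ 1 le_rfl, o₂] at this
      rw [← this, wLength_eq, wLength_eq]
      apply intervalIntegral.integral_congr_Ioo_of_le one_le_two
      intro s hs
      apply wSpeed_congr
      filter_upwards [Ioi_mem_nhds hs.1] with u hu using e₂ u (le_of_lt hu)
    rw [← s1, ← s2, wLength_eq, wLength_eq, wLength_eq,
      intervalIntegral.integral_add_adjacent_intervals (i 0 1) (i 1 2)]
  rw [← c0, ← c2, ← key]
  exact wDist_le m c zero_le_two hc

/-- unit speed -/
def USpeed (m : ℝ → ℝ) (c : ℝ → ℝ × ℝ) : Prop :=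
  ∀ s, (deriv (fun u => (c u).1) s) ^ 2 + m (c s).1 ^ 2 * (deriv (fun u => (c u).2) s) ^ 2 = 1

lemma USpeed.length {m : ℝ → ℝ} {c : ℝ → ℝ × ℝ} (h : USpeed m c) (a b : ℝ) :
    wLength m c a b = b - a := by
  have : wSpeed m c = fun _ => (1:ℝ) := by
    funext s
    unfold wSpeed
    rw [h s, Real.sqrt_one]
  rw [wLength_eq, this]
  simp

lemma sub_minimal {m : ℝ → ℝ} (hm : Continuous m) {c : ℝ → ℝ × ℝ} (hc : ContDiff ℝ 1 c)
    (hu : USpeed m c) {L s : ℝ} (hL : wDist m (c 0) (c L) = L) (hs : 0 ≤ s) (hsL : s ≤ L) :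
    ∀ {c' : ℝ → ℝ × ℝ} {b : ℝ}, 0 ≤ b → ContDiff ℝ 1 c' → c' 0 = c 0 → c' b = c s →
      s ≤ wLength m c' 0 b := by
  intro c' b hb hc' h0 hbs
  have hc2 : ContDiff ℝ 1 (fun u => c (s + u)) := hc.comp (contDiff_const.add contDiff_id)
  have := wDist_triangle hm hb (sub_nonneg.2 hsL) hc' hc2 (by simpa using hbs)
  have l2 : wLength m (fun u => c (s + u)) 0 (L - s) = L - s := by
    have := wLength_comp hm hc (φ := fun u => s + u) (contDiff_const.add contDiff_id)
      (fun x y h => by simpa using h) 0 (L - s)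
    rw [this, hu.length]; ring
  rw [l2, h0] at this
  simp only [add_sub_cancel] at this
  linarith

/-- Scaling the second coordinate about its initial value. -/
def scl (c : ℝ → ℝ × ℝ) (l : ℝ) (s : ℝ) : ℝ × ℝ :=
  ((c s).1, (c 0).2 + l * ((c s).2 - (c 0).2))

lemma scl_contDiff {c : ℝ → ℝ × ℝ} (hc : ContDiff ℝ 1 c) (l : ℝ) : ContDiff ℝ 1 (scl c l) := by
  have := hc.fst
  have := hc.snd
  unfold scl
  fun_prop

lemma scl_deriv {c : ℝ → ℝ × ℝ} (hc : ContDiff ℝ 1 c) (l s : ℝ) :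
    deriv (fun u => (scl c l u).2) s = l * deriv (fun u => (c u).2) s := by
  have d2 : DifferentiableAt ℝ (fun u => (c u).2) s :=
    (hc.snd.differentiable one_ne_zero) _
  exact (((d2.hasDerivAt.sub_const (c 0).2).const_mul l).const_add (c 0).2).deriv

lemma scl_uspeed {m : ℝ → ℝ} {c : ℝ → ℝ × ℝ} (hc : ContDiff ℝ 1 c) {l : ℝ} (hl : l ^ 2 = 1)
    (hu : USpeed m c) : USpeed m (scl c l) := by
  intro s
  rw [scl_deriv hc, mul_pow, hl, one_mul]
  exact hu s

/-- If two minimal segments reach the same `t` level at the same time, their `θ` displacements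
agree in absolute value. -/
lemma theta_le {m : ℝ → ℝ} (hm : Continuous m) (hpos : ∀ t, 0 < m t) {c d : ℝ → ℝ × ℝ}
    (hc : ContDiff ℝ 1 c) (hu : USpeed m c) (h0 : d 0 = c 0) {s : ℝ} (hs : 0 < s)
    (hmin : ∀ {c' : ℝ → ℝ × ℝ} {b : ℝ}, 0 ≤ b → ContDiff ℝ 1 c' → c' 0 = d 0 → c' b = d s →
      s ≤ wLength m c' 0 b)
    {ν : ℝ} (hν : ∀ s, m (c s).1 ^ 2 * deriv (fun u => (c u).2) s = ν)
    (ht : (c s).1 = (d s).1) :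
    |(c s).2 - (c 0).2| ≤ |(d s).2 - (c 0).2| := by
  by_contra hlt
  push Not at hlt
  have hne : (c s).2 - (c 0).2 ≠ 0 := by
    intro h
    rw [h, abs_zero] at hlt
    exact absurd (abs_nonneg ((d s).2 - (c 0).2)) (not_le.2 hlt)
  have hν0 : ν ≠ 0 := by
    intro h
    apply hne
    have hd0 : ∀ u, deriv (fun u => (c u).2) u = 0 := fun u => by
      have := hν u
      rw [h] at this
      exact (mul_eq_zero.1 this).resolve_left (pow_ne_zero 2 (hpos _).ne')
    have := is_const_of_deriv_eq_zero (hc.snd.differentiable one_ne_zero) hd0 s 0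
    exact sub_eq_zero.2 this
  set l := ((d s).2 - (c 0).2) / ((c s).2 - (c 0).2) with hl
  have hl1 : l ^ 2 < 1 := by
    rw [sq_lt_one_iff_abs_lt_one, hl, abs_div, div_lt_one (abs_pos.2 hne)]
    exact hlt
  have e0 : scl c l 0 = d 0 := by rw [h0]; simp [scl]
  have es : scl c l s = d s := by
    unfold scl
    rw [hl, div_mul_cancel₀ _ hne, ht]
    ext <;> simp
  have h := hmin hs.le (scl_contDiff hc l) e0 es
  have hlt : wLength m (scl c l) 0 s < ∫ _ in (0:ℝ)..s, (1:ℝ) := by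
    rw [wLength_eq]
    apply intervalIntegral.integral_lt_integral_of_continuousOn_of_le_of_exists_lt hs
      (wSpeed_continuous hm (scl_contDiff hc l)).continuousOn continuousOn_const
    · intro u _
      unfold wSpeed
      rw [scl_deriv hc, mul_pow, Real.sqrt_le_iff]
      refine ⟨zero_le_one, ?_⟩
      have := hu u
      have k : 0 ≤ m (c u).1 ^ 2 * (deriv (fun u => (c u).2) u) ^ 2 := by positivity
      simp only [scl]
      nlinarith
    · refine ⟨0, ⟨le_rfl, hs.le⟩, ?_⟩
      unfold wSpeed
      rw [scl_deriv hc, mul_pow, Real.sqrt_lt' one_pos]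
      have := hu 0
      have hd : deriv (fun u => (c u).2) 0 ≠ 0 := by
        intro h
        apply hν0
        rw [← hν 0, h, mul_zero]
      have k : 0 < m (c 0).1 ^ 2 * (deriv (fun u => (c u).2) 0) ^ 2 := by
        have := hpos (c 0).1
        positivity
      simp only [scl]
      nlinarith
  rw [intervalIntegral.integral_const, smul_eq_mul, mul_one, sub_zero] at hlt
  linarith

/-- Cutting a corner. -/
lemma corner {m : ℝ → ℝ} (hm : Continuous m) (hpos : ∀ t, 0 < m t) {c d : ℝ → ℝ × ℝ}
    (hc : ContDiff ℝ 1 c) (hd : ContDiff ℝ 1 d) (huc : USpeed m c) (hud : USpeed m d)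
    (h0 : c 0 = d 0) {s L : ℝ} (hs : 0 < s) (hsL : s < L) (hcd : c s = d s)
    (hmin : wDist m (d 0) (d L) = L) :
    deriv (fun u => (c u).1) s = deriv (fun u => (d u).1) s := by
  by_contra hne
  have hc1 : HasDerivAt (fun u => (c u).1) (deriv (fun u => (c u).1) s) s :=
    ((hc.fst.differentiable one_ne_zero) _).hasDerivAt
  have hc2 : HasDerivAt (fun u => (c u).2) (deriv (fun u => (c u).2) s) s :=
    ((hc.snd.differentiable one_ne_zero) _).hasDerivAt
  have hd1 : HasDerivAt (fun u => (d u).1) (deriv (fun u => (d u).1) s) s :=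
    ((hd.fst.differentiable one_ne_zero) _).hasDerivAt
  have hd2 : HasDerivAt (fun u => (d u).2) (deriv (fun u => (d u).2) s) s :=
    ((hd.snd.differentiable one_ne_zero) _).hasDerivAt
  have uc := huc s
  have ud := hud s
  set v1 := deriv (fun u => (c u).1) s
  set v2 := deriv (fun u => (c u).2) s
  set w1 := deriv (fun u => (d u).1) s
  set w2 := deriv (fun u => (d u).2) s
  rw [← hcd] at ud
  set μ := m (c s).1
  have hμ : 0 < μ := hpos _
  have lt4 : (v1 + w1) ^ 2 + μ ^ 2 * (v2 + w2) ^ 2 < 4 := by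
    have : 0 < (v1 - w1) ^ 2 := by
      have := sub_ne_zero.2 hne
      positivity
    have : 0 ≤ μ ^ 2 * (v2 - w2) ^ 2 := by positivity
    nlinarith
  -- a slightly larger M
  obtain ⟨M, hM, hM4⟩ : ∃ M, μ < M ∧ (v1 + w1) ^ 2 + M ^ 2 * (v2 + w2) ^ 2 < 4 := by
    have hcont : Continuous fun M : ℝ => (v1 + w1) ^ 2 + M ^ 2 * (v2 + w2) ^ 2 := by fun_prop
    have e1 := hcont.continuousAt.eventually_lt (continuousAt_const (y := (4:ℝ))) lt4
    have e2 := (e1.filter_mono (nhdsWithin_le_nhds (s := Ioi μ))).and self_mem_nhdsWithin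
    obtain ⟨M, h1, h2⟩ := e2.exists
    exact ⟨M, h2, h1⟩
  -- neighbourhood where m < M
  obtain ⟨r, hr, hball⟩ : ∃ r > 0, ∀ t, |t - (c s).1| < r → m t < M := by
    have := hm.continuousAt.eventually_lt (continuousAt_const (y := M)) (x₀ := (c s).1) hM
    obtain ⟨r, hr, h⟩ := Metric.eventually_nhds_iff.1 this
    exact ⟨r, hr, fun t ht => h (by simpa [Real.dist_eq] using ht)⟩
  have neg : HasDerivAt (fun h : ℝ => s - h) (-1) 0 := by
    simpa using (hasDerivAt_id (0:ℝ)).const_sub s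
  have plus : HasDerivAt (fun h : ℝ => s + h) 1 0 := by
    simpa using (hasDerivAt_id (0:ℝ)).const_add s
  have D1 : HasDerivAt (fun h => (d (s + h)).1 - (c (s - h)).1) (v1 + w1) 0 := by
    have a1 := HasDerivAt.comp (0:ℝ) (h₂ := fun u => (d u).1) (h := fun h : ℝ => s + h)
      (h₂' := w1) (by simpa using hd1) plus
    have a2 := HasDerivAt.comp (0:ℝ) (h₂ := fun u => (c u).1) (h := fun h : ℝ => s - h)
      (h₂' := v1) (by simpa using hc1) neg
    exact (a1.sub a2).congr_deriv (by ring)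
  have D2 : HasDerivAt (fun h => (d (s + h)).2 - (c (s - h)).2) (v2 + w2) 0 := by
    have a1 := HasDerivAt.comp (0:ℝ) (h₂ := fun u => (d u).2) (h := fun h : ℝ => s + h)
      (h₂' := w2) (by simpa using hd2) plus
    have a2 := HasDerivAt.comp (0:ℝ) (h₂ := fun u => (c u).2) (h := fun h : ℝ => s - h)
      (h₂' := v2) (by simpa using hc2) neg
    exact (a1.sub a2).congr_deriv (by ring)
  have T1 := D1.tendsto_slope_zero_right
  have T2 := D2.tendsto_slope_zero_right
  simp only [zero_add, add_zero, sub_zero, hcd, sub_self, smul_eq_mul] at T1 T2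
  have T := (T1.pow 2).add ((T2.pow 2).const_mul (M ^ 2))
  have E1 := T.eventually_lt_const hM4
  have E2 : ∀ᶠ h in nhdsWithin (0:ℝ) (Ioi 0), |(d (s + h)).1 - (c s).1| < r := by
    have : ContinuousAt (fun h : ℝ => |(d (s + h)).1 - (c s).1|) 0 := by
      have := hd.continuous
      fun_prop
    exact (this.eventually_lt continuousAt_const (by simpa [hcd] using hr)).filter_mono
      nhdsWithin_le_nhds
  have E3 : ∀ᶠ h in nhdsWithin (0:ℝ) (Ioi 0), |(c (s - h)).1 - (c s).1| < r := by
    have : ContinuousAt (fun h : ℝ => |(c (s - h)).1 - (c s).1|) 0 := by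
      have := hc.continuous
      fun_prop
    exact (this.eventually_lt continuousAt_const (by simpa [hcd] using hr)).filter_mono
      nhdsWithin_le_nhds
  have E4 : ∀ᶠ h in nhdsWithin (0:ℝ) (Ioi 0), h < min s (L - s) :=
    nhdsWithin_le_nhds (Iio_mem_nhds (lt_min hs (sub_pos.2 hsL)))
  obtain ⟨h, h1, h2, h3, h4, hh⟩ :=
    (E1.and (E2.and (E3.and (E4.and self_mem_nhdsWithin)))).exists
  have hh : 0 < h := hh
  have h4s : h < s := h4.trans_le (min_le_left _ _)
  have h4L : h < L - s := h4.trans_le (min_le_right _ _)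
  set P := c (s - h) with hP
  set Q := d (s + h) with hQ
  set e : ℝ → ℝ × ℝ := fun u => (P.1 + u * (Q.1 - P.1), P.2 + u * (Q.2 - P.2)) with he
  have hec : ContDiff ℝ 1 e := by
    rw [he]; fun_prop
  have e0 : e 0 = P := by simp [he]
  have e1 : e 1 = Q := by simp [he]
  have ed1 : ∀ u, deriv (fun u => (e u).1) u = Q.1 - P.1 := fun u => by
    have := (((hasDerivAt_id u).mul_const (Q.1 - P.1)).const_add P.1).deriv
    rw [one_mul] at this
    exact this
  have ed2 : ∀ u, deriv (fun u => (e u).2) u = Q.2 - P.2 := fun u => by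
    have := (((hasDerivAt_id u).mul_const (Q.2 - P.2)).const_add P.2).deriv
    rw [one_mul] at this
    exact this
  have sq4 : (Q.1 - P.1) ^ 2 + M ^ 2 * (Q.2 - P.2) ^ 2 < (2 * h) ^ 2 := by
    have : (Q.1 - P.1) ^ 2 + M ^ 2 * (Q.2 - P.2) ^ 2 =
        ((h⁻¹ * (Q.1 - P.1)) ^ 2 + M ^ 2 * (h⁻¹ * (Q.2 - P.2)) ^ 2) * h ^ 2 := by
      field_simp
    rw [this]
    have := pow_pos hh 2
    nlinarith
  have elen : wLength m e 0 1 ≤ Real.sqrt ((Q.1 - P.1) ^ 2 + M ^ 2 * (Q.2 - P.2) ^ 2) := by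
    have : wLength m e 0 1 ≤
        ∫ _ in (0:ℝ)..1, Real.sqrt ((Q.1 - P.1) ^ 2 + M ^ 2 * (Q.2 - P.2) ^ 2) := by
      rw [wLength_eq]
      apply intervalIntegral.integral_mono_on zero_le_one
        ((wSpeed_continuous hm hec).intervalIntegrable _ _)
        (continuous_const.intervalIntegrable _ _)
      intro u hu
      unfold wSpeed
      rw [ed1, ed2]
      apply Real.sqrt_le_sqrt
      have hmM : m (e u).1 < M := by
        apply hball
        rw [abs_lt] at h2 h3 ⊢
        have := (convex_Ioo ((c s).1 - r) ((c s).1 + r)).add_smul_sub_mem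
          (x := P.1) (y := Q.1) ⟨by linarith, by linarith⟩ ⟨by linarith, by linarith⟩ hu
        have hm' : P.1 + u * (Q.1 - P.1) ∈ Ioo ((c s).1 - r) ((c s).1 + r) := this
        simp only [he]
        constructor <;> linarith [hm'.1, hm'.2]
      have := hpos (e u).1
      gcongr
    simpa using this
  have elt : wLength m e 0 1 < 2 * h :=
    elen.trans_lt ((Real.sqrt_lt' (by positivity)).2 sq4)
  have tri := wDist_triangle hm (sub_nonneg.2 h4s.le) zero_le_one hc hec (by rw [e0])
  rw [huc.length, e1] at tri
  -- but d is minimal up to s + h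
  have hd' : ContDiff ℝ 1 (fun u => d (s + h + u)) :=
    hd.comp (contDiff_const.add contDiff_id)
  have hmin' : s + h ≤ wDist m (d 0) (d (s + h)) := by
    apply le_csInf
    · exact ⟨_, d, s + h, by linarith, hd, rfl, rfl, rfl⟩
    · rintro _ ⟨c', b, hb, hc', h0', hb', rfl⟩
      exact sub_minimal hm hd hud hmin (by linarith) (by linarith) hb hc' h0' hb'
  rw [h0] at tri
  linarith

/-- Backward uniqueness for a second order autonomous equation. -/
lemma ode_unique {h : ℝ → ℝ} (hh : ContDiff ℝ 1 h) {f g : ℝ → ℝ} (hf : ContDiff ℝ 2 f)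
    (hg : ContDiff ℝ 2 g) (hf2 : ∀ s, deriv (deriv f) s = h (f s))
    (hg2 : ∀ s, deriv (deriv g) s = h (g s)) {s : ℝ} (hs : 0 < s) (h0 : f s = g s)
    (h1 : deriv f s = deriv g s) : deriv f 0 = deriv g 0 := by
  obtain ⟨R, hR⟩ : ∃ R, ∀ u ∈ Icc 0 s, f u ∈ Icc (-R) R ∧ g u ∈ Icc (-R) R := by
    obtain ⟨R₁, h₁⟩ := isCompact_Icc.exists_bound_of_continuousOn
      (hf.continuous.continuousOn (s := Icc 0 s))
    obtain ⟨R₂, h₂⟩ := isCompact_Icc.exists_bound_of_continuousOn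
      (hg.continuous.continuousOn (s := Icc 0 s))
    refine ⟨max R₁ R₂, fun u hu => ⟨abs_le.1 ?_, abs_le.1 ?_⟩⟩
    · exact (h₁ u hu).trans (le_max_left _ _)
    · exact (h₂ u hu).trans (le_max_right _ _)
  obtain ⟨K, hK⟩ := hh.contDiffOn.exists_lipschitzOnWith one_ne_zero (convex_Icc (-R) R)
    isCompact_Icc
  have hl : ∀ t ∈ Ioc 0 s, LipschitzOnWith (max 1 K)
      (fun z : ℝ × ℝ => (z.2, h z.1)) (Icc (-R) R ×ˢ univ) := by
    intro t _
    have a := (LipschitzWith.prod_snd (α := ℝ) (β := ℝ)).lipschitzOnWith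
      (s := Icc (-R) R ×ˢ univ)
    have b := hK.comp ((LipschitzWith.prod_fst (α := ℝ) (β := ℝ)).lipschitzOnWith
      (s := Icc (-R) R ×ˢ univ)) (fun z hz => hz.1)
    have := a.prodMk b
    simpa using this
  have der : ∀ {f : ℝ → ℝ}, ContDiff ℝ 2 f → (∀ s, deriv (deriv f) s = h (f s)) →
      ∀ t, HasDerivAt (fun u => (f u, deriv f u)) (deriv f t, h (f t)) t := by
    intro f hf hf2 t
    have a : HasDerivAt f (deriv f t) t := ((hf.differentiable two_ne_zero) t).hasDerivAt
    have b : ContDiff ℝ 1 (deriv f) := ((contDiff_succ_iff_deriv (n := 1)).1 hf).2.2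
    have b' : HasDerivAt (deriv f) (h (f t)) t := by
      rw [← hf2]; exact ((b.differentiable one_ne_zero) t).hasDerivAt
    exact a.prodMk b'
  have := ODE_solution_unique_of_mem_Icc_left (v := fun _ z => (z.2, h z.1)) hl
    (f := fun u => (f u, deriv f u)) (g := fun u => (g u, deriv g u))
    (fun t _ => (der hf hf2 t).continuousAt.continuousWithinAt)
    (fun t _ => (der hf hf2 t).hasDerivWithinAt)
    (fun t ht => ⟨(hR t ⟨ht.1.le, ht.2⟩).1, trivial⟩)
    (fun t _ => (der hg hg2 t).continuousAt.continuousWithinAt)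
    (fun t _ => (der hg hg2 t).hasDerivWithinAt)
    (fun t ht => ⟨(hR t ⟨ht.1.le, ht.2⟩).2, trivial⟩)
    (by simp [h0, h1])
  have := this ⟨le_rfl, hs.le⟩
  exact (Prod.ext_iff.1 this).2

/-- No crossing of `t` levels. -/
lemma no_cross {m : ℝ → ℝ} (hm : ContDiff ℝ (⊤:ℕ∞) m) (hpos : ∀ t, 0 < m t)
    {c d : ℝ → ℝ × ℝ} (hc : IsUnitGeodesic m c) (hd : IsUnitGeodesic m d) (h0 : c 0 = d 0)
    {a b s : ℝ} (hca : IsMinimalSeg m c a) (hdb : IsMinimalSeg m d b)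
    (hs : 0 < s) (hsa : s < a) (hsb : s < b)
    (hne : deriv (fun u => (c u).1) 0 ≠ deriv (fun u => (d u).1) 0) :
    (c s).1 ≠ (d s).1 := by
  intro ht
  obtain ⟨c2, cg, ⟨ν, hν⟩, cu⟩ := hc
  obtain ⟨d2, dg, ⟨κ, hκ⟩, du⟩ := hd
  have cu : USpeed m c := cu
  have du : USpeed m d := du
  have c1 : ContDiff ℝ 1 c := c2.of_le one_le_two
  have d1 : ContDiff ℝ 1 d := d2.of_le one_le_two
  have mc := hm.continuous
  have t1 := theta_le mc hpos c1 cu h0.symm hs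
    (sub_minimal mc d1 du hdb hs.le hsb.le) hν ht
  have t2 := theta_le mc hpos d1 du h0 hs
    (sub_minimal mc c1 cu hca hs.le hsa.le) hκ ht.symm
  rw [← h0] at t2
  obtain ⟨l, hl, hls⟩ : ∃ l : ℝ, l ^ 2 = 1 ∧ (d s).2 - (c 0).2 = l * ((c s).2 - (c 0).2) := by
    rcases abs_eq_abs.1 (le_antisymm t2 t1) with h | h
    · exact ⟨1, by norm_num, by rw [h]; ring⟩
    · exact ⟨-1, by norm_num, by rw [h]; ring⟩
  have e0 : scl c l 0 = d 0 := by rw [← h0]; simp [scl]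
  have es : scl c l s = d s := by
    unfold scl
    rw [← hls, ht]
    ext <;> simp
  have hv := corner mc hpos (scl_contDiff c1 l) d1 (scl_uspeed c1 hl cu) du e0 hs hsb es hdb
  have hv : deriv (fun u => (c u).1) s = deriv (fun u => (d u).1) s := hv
  -- squares of the Clairaut constants agree
  have sqc : ∀ u, m (c u).1 ^ 2 * (1 - deriv (fun u => (c u).1) u ^ 2) = ν ^ 2 := fun u => by
    rw [← hν u, ← cu u]; ring
  have sqd : ∀ u, m (d u).1 ^ 2 * (1 - deriv (fun u => (d u).1) u ^ 2) = κ ^ 2 := fun u => by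
    rw [← hκ u, ← du u]; ring
  have hνκ : ν ^ 2 = κ ^ 2 := by rw [← sqc s, ← sqd s, ht, hv]
  have hm1 : ContDiff ℝ 1 (deriv m) := by
    have : ContDiff ℝ 2 m := contDiff_infty.1 hm 2
    exact ((contDiff_succ_iff_deriv (n := 1)).1 this).2.2
  have hm0 : ContDiff ℝ 1 m := hm.of_le (by exact_mod_cast le_top)
  have hh : ContDiff ℝ 1 (fun t => ν ^ 2 * deriv m t / m t ^ 3) :=
    (contDiff_const.mul hm1).div (hm0.pow 3) (fun t => pow_ne_zero 3 (hpos t).ne')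
  apply hne
  refine ode_unique hh c2.fst d2.fst ?_ ?_ hs ht hv
  · intro u
    rw [cg u, ← hν u]
    have := (hpos (c u).1).ne'
    field_simp
  · intro u
    rw [dg u, hνκ, ← hκ u]
    have := (hpos (d u).1).ne'
    field_simp

lemma compare {m : ℝ → ℝ} (hm : ContDiff ℝ (⊤:ℕ∞) m) (hpos : ∀ t, 0 < m t)
    {c d : ℝ → ℝ × ℝ} (hc : IsUnitGeodesic m c) (hd : IsUnitGeodesic m d) (h0 : c 0 = d 0)
    {a b r : ℝ} (hca : IsMinimalSeg m c a) (hdb : IsMinimalSeg m d b)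
    (hr : 0 < r) (hra : r ≤ a) (hrb : r ≤ b)
    (hlt : deriv (fun u => (d u).1) 0 < deriv (fun u => (c u).1) 0) :
    ∀ s ∈ Icc 0 r, (d s).1 ≤ (c s).1 := by
  have cont : Continuous fun s => (c s).1 - (d s).1 :=
    hc.1.continuous.fst.sub hd.1.continuous.fst
  have nz : ∀ s ∈ Ioo 0 r, (c s).1 - (d s).1 ≠ 0 := fun s hs => sub_ne_zero.2
    (no_cross hm hpos hc hd h0 hca hdb hs.1 (hs.2.trans_le hra) (hs.2.trans_le hrb) hlt.ne')
  have D : HasDerivAt (fun s => (c s).1 - (d s).1)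
      (deriv (fun u => (c u).1) 0 - deriv (fun u => (d u).1) 0) 0 :=
    ((hc.1.fst.differentiable two_ne_zero) 0).hasDerivAt.sub
      ((hd.1.fst.differentiable two_ne_zero) 0).hasDerivAt
  have T := D.tendsto_slope_zero_right
  simp only [zero_add, h0, sub_self, sub_zero, smul_eq_mul] at T
  have E := T.eventually_const_lt (sub_pos.2 hlt)
  have E4 : ∀ᶠ h in nhdsWithin (0:ℝ) (Ioi 0), h < r :=
    nhdsWithin_le_nhds (Iio_mem_nhds hr)
  obtain ⟨h, e1, e2, e3⟩ := (E.and (E4.and self_mem_nhdsWithin)).exists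
  have e3 : 0 < h := e3
  have hpos' : 0 < (c h).1 - (d h).1 := by
    have : 0 < h⁻¹ := inv_pos.2 e3
    exact pos_of_mul_pos_right e1 this.le
  have key : ∀ s ∈ Ioo 0 r, 0 ≤ (c s).1 - (d s).1 := by
    intro s hs
    by_contra hneg
    push Not at hneg
    have conn : IsPreconnected (Ioo 0 r) := isPreconnected_Ioo
    obtain ⟨z, hz, hz0⟩ := conn.intermediate_value hs ⟨e3, e2⟩ cont.continuousOn
      (show (0:ℝ) ∈ Icc _ _ from ⟨hneg.le, hpos'.le⟩)
    exact nz z hz hz0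
  have cl : closure (Ioo 0 r) ⊆ {s | 0 ≤ (c s).1 - (d s).1} :=
    closure_minimal key (isClosed_le continuous_const cont)
  rw [closure_Ioo hr.ne] at cl
  intro s hs
  exact sub_nonneg.1 (cl hs)

/-- Lemma 4.4: with `α`, `β` minimal geodesic segments from `p̃` to a cut
point `y` bounding a sector `D`, and `γ|[0,a]` a minimal geodesic segment from `p̃` to an
end point `x ∈ D` of the cut locus with `a ≤ L(α) = L(β)`, if the initial angles with
`∂/∂t` satisfy `∠(α'(0)) < ∠(γ'(0)) < ∠(β'(0))`, then
`t(α(s)) ≥ t(γ(s)) ≥ t(β(s))` for all `s ∈ [0,a]`. -/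
theorem stmt10 (m : ℝ → ℝ) (hm : ContDiff ℝ (⊤:ℕ∞) m) (hmpos : ∀ t, 0 < m t)
    (hmeven : ∀ t, m (-t) = m t)
    (p y x : ℝ × ℝ) (hy : IsCutPoint m p y)
    (α β γ : ℝ → ℝ × ℝ) (Lα Lβ a : ℝ) (hLα : 0 < Lα) (hLβ : 0 < Lβ) (ha : 0 < a)
    (hα : IsUnitGeodesic m α) (hβ : IsUnitGeodesic m β) (hγ : IsUnitGeodesic m γ)
    (hα0 : α 0 = p) (hβ0 : β 0 = p) (hγ0 : γ 0 = p)
    (hαL : α Lα = y) (hβL : β Lβ = y) (hγa : γ a = x)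
    (hαmin : IsMinimalSeg m α Lα) (hβmin : IsMinimalSeg m β Lβ)
    (hγmin : IsMinimalSeg m γ a)
    (D : Set (ℝ × ℝ)) (hD : IsSectorOf α β Lα Lβ D)
    (hx : IsEndPoint m p x) (hxD : x ∈ D)
    (haL : a ≤ Lα) (hLL : Lα = Lβ)
    (hangle₁ : Real.arccos (deriv (fun u => (α u).1) 0) <
      Real.arccos (deriv (fun u => (γ u).1) 0))
    (hangle₂ : Real.arccos (deriv (fun u => (γ u).1) 0) <
      Real.arccos (deriv (fun u => (β u).1) 0)) :
    ∀ s ∈ Set.Icc (0:ℝ) a, (β s).1 ≤ (γ s).1 ∧ (γ s).1 ≤ (α s).1 := by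
  have bd : ∀ {c : ℝ → ℝ × ℝ}, IsUnitGeodesic m c →
      deriv (fun u => (c u).1) 0 ∈ Icc (-1:ℝ) 1 := by
    intro c hc
    have h := hc.2.2.2 0
    have : 0 ≤ m (c 0).1 ^ 2 * (deriv (fun u => (c u).2) 0) ^ 2 := by positivity
    exact abs_le.1 ((sq_le_one_iff_abs_le_one _).1 (by linarith))
  have l1 := (Real.strictAntiOn_arccos.lt_iff_gt (bd hα) (bd hγ)).1 hangle₁
  have l2 := (Real.strictAntiOn_arccos.lt_iff_gt (bd hγ) (bd hβ)).1 hangle₂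
  intro s hs
  exact ⟨compare hm hmpos hγ hβ (hγ0.trans hβ0.symm) hγmin hβmin ha le_rfl (hLL ▸ haL) l2 s hs,
    compare hm hmpos hα hγ (hα0.trans hγ0.symm) hαmin hγmin ha haL le_rfl l1 s hs⟩
end
end
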